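/- arXiv:2004.03832 — 2 statements merged into one kernel-verified Lean document; each statement's English description precedes it below -/
import Mathlib

section
/- (Linear scattering with asymptotic order, Fourier formulation, μ ≠ 1/4.) Let d ≥ 1 and μ > 0 with μ ≠ 1/4. Let g₀, g₁ : ℝ^d → ℂ be measurable with ‖g₀‖_{L²} + ‖|ξ|g₀‖_{L²} + ‖g₁‖_{L²} < ∞, and set v̂(t,ξ) := E_0(t,0,ξ) g₀(ξ) + E_1(t,0,ξ) g₁(ξ) and ∂_t v̂(t,ξ) := Ė_0(t,0,ξ) g₀(ξ) + Ė_1(t,0,ξ) g₁(ξ). Then there exist measurable g₊, h₊ : ℝ^d → ℂ with ‖|ξ|g₊‖_{L²} + ‖h₊‖_{L²} < ∞ and a constant C > 0 depending only on d and μ (in particular independent of t and of g₀, g₁) such that for all t ≥ 0: ‖ |ξ| v̂(t,·) − |ξ| cos(t|ξ|) g₊ − sin(t|ξ|) h₊ ‖_{L²} + ‖ ∂_t v̂(t,·) + |ξ| sin(t|ξ|) g₊ − cos(t|ξ|) h₊ ‖_{L²} ≤ C μ (1+t)^{−1/2 + Re ν} (‖g₀‖_{L²} + ‖g₁‖_{L²}).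 (This is the statement, via Plancherel, that the solution of ∂_t²v − Δv + μ(1+t)^{−2}v = 0 converges in Ḣ¹ × L² to a free wave ℱ⁻¹(cos(t|ξ|)g₊ + |ξ|⁻¹ sin(t|ξ|)h₊) with rate (1+t)^{−1/2+Re ν}.) -/
open MeasureTheory Real Set

noncomputable section

/-- Bessel function of the first kind `J_ν(τ)`, defined by its power series,
using the principal branch of `(τ/2)^(ν+2k)`. -/
def besselJ (ν : ℂ) (τ : ℝ) : ℂ :=
  ∑' k : ℕ, ((-1 : ℂ) ^ k / ((Nat.factorial k : ℂ) * Complex.Gamma (ν + k + 1))) *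
    ((τ : ℂ) / 2) ^ (ν + 2 * (k : ℂ))

/-- Bessel function of the second kind (Neumann function) `Y_ν(τ)` for `ν ∉ ℤ`. -/
def besselY (ν : ℂ) (τ : ℝ) : ℂ :=
  (besselJ ν τ * Complex.cos (ν * (π : ℂ)) - besselJ (-ν) τ) / Complex.sin (ν * (π : ℂ))

/-- The index `ν` associated with the mass parameter `μ`. -/
def nuOf (μ : ℝ) : ℂ :=
  if μ ≤ 1 / 4 then ((Real.sqrt (1 - 4 * μ) / 2 : ℝ) : ℂ)
  else Complex.I * ((Real.sqrt (4 * μ - 1) / 2 : ℝ) : ℂ)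

/-- `e₊(t,ξ) = τ^{1/2} J_ν(τ)` with `τ = (1+t) r`, `r = |ξ|`. -/
def ePlus (ν : ℂ) (r t : ℝ) : ℂ :=
  (Real.sqrt ((1 + t) * r) : ℂ) * besselJ ν ((1 + t) * r)

/-- `e₋(t,ξ) = τ^{1/2} Y_ν(τ)` with `τ = (1+t) r`, `r = |ξ|`. -/
def eMinus (ν : ℂ) (r t : ℝ) : ℂ :=
  (Real.sqrt ((1 + t) * r) : ℂ) * besselY ν ((1 + t) * r)

/-- `ė₊ = ∂ₜ e₊`. -/
def ePlusDot (ν : ℂ) (r t : ℝ) : ℂ := deriv (ePlus ν r) t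

/-- `ė₋ = ∂ₜ e₋`. -/
def eMinusDot (ν : ℂ) (r t : ℝ) : ℂ := deriv (eMinus ν r) t

/-- The Fourier multiplier `E₀(t,t₀,ξ)` of the Klein–Gordon propagator. -/
def E0 (ν : ℂ) (r t t₀ : ℝ) : ℂ :=
  (ePlus ν r t * eMinusDot ν r t₀ - ePlusDot ν r t₀ * eMinus ν r t) /
    (ePlus ν r t₀ * eMinusDot ν r t₀ - ePlusDot ν r t₀ * eMinus ν r t₀)

/-- The Fourier multiplier `E₁(t,t₀,ξ)` of the Klein–Gordon propagator. -/
def E1 (ν : ℂ) (r t t₀ : ℝ) : ℂ :=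
  (ePlus ν r t₀ * eMinus ν r t - ePlus ν r t * eMinus ν r t₀) /
    (ePlus ν r t₀ * eMinusDot ν r t₀ - ePlusDot ν r t₀ * eMinus ν r t₀)

/-- `Ė₀ = ∂ₜ E₀` (derivative in the first time variable). -/
def E0dot (ν : ℂ) (r t t₀ : ℝ) : ℂ := deriv (fun s => E0 ν r s t₀) t

/-- `Ė₁ = ∂ₜ E₁` (derivative in the first time variable). -/
def E1dot (ν : ℂ) (r t t₀ : ℝ) : ℂ := deriv (fun s => E1 ν r s t₀) t

/-- The Neumann function `Y₀(τ)` (logarithmic case `ν = 0`). -/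
def besselY0 (τ : ℝ) : ℂ :=
  (2 / (π : ℂ)) * (Complex.log ((τ : ℂ) / 2) + (Real.eulerMascheroniConstant : ℂ)) * besselJ 0 τ +
    (2 / (π : ℂ)) * ∑' k : ℕ,
      ((-1 : ℂ) ^ ((k + 1) + 1) * ((harmonic (k + 1) : ℚ) : ℂ) /
          ((Nat.factorial (k + 1) : ℂ)) ^ 2) * ((τ : ℂ) / 2) ^ (2 * (k + 1))

/-- `e₋(t,ξ) = τ^{1/2} Y₀(τ)` in the case `μ = 1/4`, `ν = 0`. -/
def eMinusZ (r t : ℝ) : ℂ :=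
  (Real.sqrt ((1 + t) * r) : ℂ) * besselY0 ((1 + t) * r)

/-- `ė₋ = ∂ₜ e₋` in the case `μ = 1/4`. -/
def eMinusZDot (r t : ℝ) : ℂ := deriv (eMinusZ r) t

/-- `E₀(t,t₀,ξ)` in the case `μ = 1/4`, `ν = 0`. -/
def E0Z (r t t₀ : ℝ) : ℂ :=
  (ePlus 0 r t * eMinusZDot r t₀ - ePlusDot 0 r t₀ * eMinusZ r t) /
    (ePlus 0 r t₀ * eMinusZDot r t₀ - ePlusDot 0 r t₀ * eMinusZ r t₀)

/-- `E₁(t,t₀,ξ)` in the case `μ = 1/4`, `ν = 0`. -/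
def E1Z (r t t₀ : ℝ) : ℂ :=
  (ePlus 0 r t₀ * eMinusZ r t - ePlus 0 r t * eMinusZ r t₀) /
    (ePlus 0 r t₀ * eMinusZDot r t₀ - ePlusDot 0 r t₀ * eMinusZ r t₀)

/-- `Ė₀` in the case `μ = 1/4`. -/
def E0Zdot (r t t₀ : ℝ) : ℂ := deriv (fun s => E0Z r s t₀) t

/-- `Ė₁` in the case `μ = 1/4`. -/
def E1Zdot (r t t₀ : ℝ) : ℂ := deriv (fun s => E1Z r s t₀) t


/-- `v` solves `v'' + (r² + μ (1 + t)⁻²) v = 0` on `(-1, ∞)`, with derivative `v'`. -/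
def IsModeSolution (μ r : ℝ) (v v' : ℝ → ℂ) : Prop :=
  ∀ t : ℝ, -1 < t → HasDerivAt v (v' t) t ∧
    HasDerivAt v' (-((r ^ 2 + μ / (1 + t) ^ 2 : ℝ) : ℂ) * v t) t

/-! ### Power series with factorially decaying coefficients -/

theorem summable_of_le_div_factorial {c : ℕ → ℂ} {K : ℝ}
    (hc : ∀ k, ‖c k‖ ≤ K / (k.factorial : ℝ)) (z : ℂ) :
    Summable fun k => c k * z ^ k := by
  refine Summable.of_norm_bounded
    (g := fun k : ℕ => K * (‖z‖ ^ k / (k.factorial : ℝ)))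
    ((Real.summable_pow_div_factorial ‖z‖).mul_left K) fun k => ?_
  rw [norm_mul, norm_pow]
  calc ‖c k‖ * ‖z‖ ^ k ≤ K / (k.factorial : ℝ) * ‖z‖ ^ k := by gcongr; exact hc k
    _ = _ := by ring

theorem norm_succ_mul_le_div_factorial {c : ℕ → ℂ} {K : ℝ}
    (hc : ∀ k, ‖c k‖ ≤ K / (k.factorial : ℝ)) (k : ℕ) :
    ‖((k : ℂ) + 1) * c (k + 1)‖ ≤ K / (k.factorial : ℝ) := by
  have h := hc (k + 1)
  have e : ‖((k : ℂ) + 1)‖ = (k : ℝ) + 1 := by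
    have := Complex.norm_natCast (k + 1)
    push_cast at this
    exact this
  rw [norm_mul, e]
  calc ((k : ℝ) + 1) * ‖c (k + 1)‖ ≤ ((k : ℝ) + 1) * (K / ((k + 1).factorial : ℝ)) := by gcongr
    _ = K / (k.factorial : ℝ) := by
      rw [Nat.factorial_succ]; push_cast
      have : (k.factorial : ℝ) ≠ 0 := by positivity
      have : (k : ℝ) + 1 ≠ 0 := by positivity
      field_simp

theorem hasDerivAt_tsum_of_le_div_factorial {c : ℕ → ℂ} {K : ℝ}
    (hc : ∀ k, ‖c k‖ ≤ K / (k.factorial : ℝ)) (z : ℂ) :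
    HasDerivAt (fun z => ∑' k, c k * z ^ k) (∑' k : ℕ, ((k : ℂ) + 1) * c (k + 1) * z ^ k) z := by
  set R := ‖z‖ + 1
  have hR : 0 ≤ R := by positivity
  have hK : 0 ≤ K := by simpa using (norm_nonneg _).trans (hc 0)
  have hu : Summable fun k : ℕ => (k : ℝ) * (K / (k.factorial : ℝ)) * R ^ (k - 1) := by
    rw [← summable_nat_add_iff 1]
    refine ((Real.summable_pow_div_factorial R).mul_left K).congr fun k => ?_
    rw [Nat.factorial_succ]; push_cast
    have : (k.factorial : ℝ) ≠ 0 := by positivity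
    have : (k : ℝ) + 1 ≠ 0 := by positivity
    field_simp
  have key := hasDerivAt_tsum_of_isPreconnected hu (t := Metric.ball (0 : ℂ) R)
    (g := fun k z => c k * z ^ k) (g' := fun k z => c k * (k * z ^ (k - 1)))
    Metric.isOpen_ball (convex_ball _ _).isPreconnected
    (fun n y _ => (hasDerivAt_pow n y).const_mul (c n))
    (fun n y hy => by
      have hy' : ‖y‖ ≤ R := by simpa using (mem_ball_zero_iff.1 hy).le
      rw [norm_mul, norm_mul, norm_pow, Complex.norm_natCast]
      calc ‖c n‖ * (n * ‖y‖ ^ (n - 1)) ≤ (K / n.factorial) * (n * R ^ (n - 1)) := by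
            gcongr; exact hc n
        _ = _ := by ring)
    (y₀ := 0) (by simp [R]; positivity) (summable_of_le_div_factorial hc 0)
    (y := z) (by simp [R])
  refine key.congr_deriv ?_
  have hs : Summable fun k : ℕ => c k * (k * z ^ (k - 1)) := by
    rw [← summable_nat_add_iff 1]
    refine (summable_of_le_div_factorial (norm_succ_mul_le_div_factorial hc) z).congr fun k => ?_
    push_cast; ring
  rw [hs.tsum_eq_zero_add]
  simp only [Nat.cast_zero, zero_mul, mul_zero, zero_add, Nat.cast_add, Nat.cast_one,
    add_tsub_cancel_right]
  exact tsum_congr fun k => by ring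

/-! ### The Bessel equation -/

/-- Coefficients of the entire series `S` with `J_ν(τ) = (τ/2)^ν S(τ²)`. -/
def besselCoeff (ν : ℂ) (k : ℕ) : ℂ :=
  (-1 / 4 : ℂ) ^ k / ((Nat.factorial k : ℂ) * Complex.Gamma (ν + k + 1))

theorem add_natCast_add_one_re_ge {ν : ℂ} (hν : -(1 / 2) ≤ ν.re) (k : ℕ) :
    (1 / 2 : ℝ) ≤ (ν + k + 1).re := by
  have : (0 : ℝ) ≤ k := by positivity
  simp
  linarith

theorem ne_zero_of_half_le_re {z : ℂ} (hz : (1 / 2 : ℝ) ≤ z.re) : z ≠ 0 := by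
  rintro rfl
  norm_num at hz

theorem besselCoeff_succ {ν : ℂ} (hν : -(1 / 2) ≤ ν.re) (k : ℕ) :
    4 * ((k : ℂ) + 1) * (ν + k + 1) * besselCoeff ν (k + 1) = -besselCoeff ν k := by
  have hre := add_natCast_add_one_re_ge hν k
  have h0 := ne_zero_of_half_le_re hre
  have hG : Complex.Gamma (ν + k + 1) ≠ 0 :=
    Complex.Gamma_ne_zero_of_re_pos (by linarith)
  have hk : (k : ℂ) + 1 ≠ 0 := Nat.cast_add_one_ne_zero k
  have hf : (k.factorial : ℂ) ≠ 0 := by exact_mod_cast k.factorial_ne_zero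
  unfold besselCoeff
  rw [Nat.factorial_succ]
  push_cast
  rw [← add_assoc ν (k : ℂ) 1, Complex.Gamma_add_one _ h0]
  field_simp
  ring

theorem norm_besselCoeff_le {ν : ℂ} (hν : -(1 / 2) ≤ ν.re) (k : ℕ) :
    ‖besselCoeff ν k‖ ≤ ‖besselCoeff ν 0‖ / (k.factorial : ℝ) := by
  induction k with
  | zero => simp
  | succ k ih =>
    have hre := add_natCast_add_one_re_ge hν k
    have h1 : (1 / 2 : ℝ) ≤ ‖ν + k + 1‖ := hre.trans (Complex.re_le_norm _)
    have h2 := congrArg norm (besselCoeff_succ hν k)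
    have e : ‖((k : ℂ) + 1)‖ = (k : ℝ) + 1 := by
      have := Complex.norm_natCast (k + 1)
      push_cast at this
      exact this
    rw [norm_neg, norm_mul, norm_mul, norm_mul, e, show ‖(4 : ℂ)‖ = 4 by simp] at h2
    have h3 : ((k : ℝ) + 1) * ‖besselCoeff ν (k + 1)‖ ≤ ‖besselCoeff ν k‖ := by
      rw [← h2]
      have : 0 ≤ ((k : ℝ) + 1) * ‖besselCoeff ν (k + 1)‖ := by positivity
      nlinarith
    rw [Nat.factorial_succ]
    push_cast
    rw [le_div_iff₀ (by positivity)]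
    rw [le_div_iff₀ (by positivity)] at ih
    calc _ = (((k : ℝ) + 1) * ‖besselCoeff ν (k + 1)‖) * k.factorial := by ring
      _ ≤ ‖besselCoeff ν k‖ * k.factorial := by gcongr
      _ ≤ _ := ih

theorem sqrt_mul_besselJ {ν : ℂ} {τ : ℝ} (hτ : 0 < τ) :
    (Real.sqrt τ : ℂ) * besselJ ν τ =
      (1 / 2 : ℂ) ^ ν * ((τ : ℂ) ^ (1 / 2 + ν) * ∑' k, besselCoeff ν k * ((τ : ℂ) ^ 2) ^ k) := by
  have hτ' : (τ : ℂ) ≠ 0 := by exact_mod_cast hτ.ne'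
  have h2 : (τ : ℂ) / 2 ≠ 0 := by simpa using hτ'
  have e1 : besselJ ν τ = ((τ : ℂ) / 2) ^ ν * ∑' k, besselCoeff ν k * ((τ : ℂ) ^ 2) ^ k := by
    unfold besselJ
    rw [← tsum_mul_left]
    refine tsum_congr fun k => ?_
    rw [Complex.cpow_add _ _ h2, show (2 * (k : ℂ)) = ((2 * k : ℕ) : ℂ) by push_cast; ring,
      Complex.cpow_natCast, pow_mul]
    unfold besselCoeff
    rw [show (-1 / 4 : ℂ) ^ k = (-1) ^ k * (1 / 4) ^ k by rw [← mul_pow]; norm_num,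
      show ((τ : ℂ) / 2) ^ 2 = (1 / 4) * (τ : ℂ) ^ 2 by ring, mul_pow]
    ring
  have e2 : ((τ : ℂ) / 2) ^ ν = (1 / 2 : ℂ) ^ ν * (τ : ℂ) ^ ν := by
    have := Complex.mul_cpow_ofReal_nonneg (a := 1 / 2) (b := τ) (by norm_num) hτ.le ν
    push_cast at this
    rw [← this]
    congr 1
    ring
  have e3 : (Real.sqrt τ : ℂ) = (τ : ℂ) ^ (1 / 2 : ℂ) := by
    rw [Real.sqrt_eq_rpow, Complex.ofReal_cpow hτ.le]
    norm_num
  rw [e1, e2, e3, Complex.cpow_add _ _ hτ']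
  ring

theorem exists_hasDerivAt_sqrt_mul_besselJ {ν : ℂ} {μ : ℝ} (hν : -(1 / 2) ≤ ν.re)
    (hμ : (μ : ℂ) = 1 / 4 - ν ^ 2) :
    ∃ f' : ℝ → ℂ, ∀ τ : ℝ, 0 < τ →
      HasDerivAt (fun τ : ℝ => (Real.sqrt τ : ℂ) * besselJ ν τ) (f' τ) τ ∧
      HasDerivAt f' (-(1 + (μ : ℂ) / (τ : ℂ) ^ 2) * ((Real.sqrt τ : ℂ) * besselJ ν τ)) τ := by
  have hc := norm_besselCoeff_le hν
  have hc' := norm_succ_mul_le_div_factorial hc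
  set S : ℂ → ℂ := fun z => ∑' k, besselCoeff ν k * z ^ k with hS
  set S' : ℂ → ℂ := fun z => ∑' k : ℕ, ((k : ℂ) + 1) * besselCoeff ν (k + 1) * z ^ k with hS'
  set S'' : ℂ → ℂ := fun z =>
    ∑' k : ℕ, ((k : ℂ) + 1) * (((k + 1 : ℕ) : ℂ) + 1) * besselCoeff ν (k + 1 + 1) * z ^ k with hS''
  have dS : ∀ z, HasDerivAt S (S' z) z := hasDerivAt_tsum_of_le_div_factorial hc
  have dS' : ∀ z, HasDerivAt S' (S'' z) z := fun z => by
    have := hasDerivAt_tsum_of_le_div_factorial hc' z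
    refine this.congr_deriv ?_
    exact tsum_congr fun k => by ring
  have ode : ∀ z, z * S'' z + (ν + 1) * S' z + S z / 4 = 0 := fun z => by
    have s1 := summable_of_le_div_factorial hc' z
    have s0 := summable_of_le_div_factorial hc z
    have s2 := summable_of_le_div_factorial (norm_succ_mul_le_div_factorial hc') z
    have e2 : HasSum (fun k : ℕ => (k : ℂ) * (((k : ℂ) + 1) * besselCoeff ν (k + 1)) * z ^ k)
        (z * S'' z) := by
      rw [← hasSum_nat_add_iff' 1]
      have := s2.hasSum.mul_left z
      have e : z * S'' z - ∑ k ∈ Finset.range 1,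
          (k : ℂ) * (((k : ℂ) + 1) * besselCoeff ν (k + 1)) * z ^ k = z * ∑' k : ℕ,
          ((k : ℂ) + 1) * ((((k + 1 : ℕ) : ℂ) + 1) * besselCoeff ν (k + 1 + 1)) * z ^ k := by
        simp only [Finset.sum_range_one, Nat.cast_zero, zero_mul, sub_zero, hS'']
        congr 1
        exact tsum_congr fun k => by ring
      rw [e]
      refine this.congr_fun fun k => ?_
      push_cast; ring
    have := (e2.add (s1.hasSum.mul_left (ν + 1))).add (s0.hasSum.div_const 4)
    refine this.unique (hasSum_zero.congr_fun fun k => ?_)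
    linear_combination z ^ k / 4 * besselCoeff_succ hν k
  set D := (1 / 2 : ℂ) ^ ν
  set a := 1 / 2 + ν with ha
  refine ⟨fun τ => D * (a * (τ : ℂ) ^ (a - 1) * S ((τ : ℂ) ^ 2) +
    (τ : ℂ) ^ a * (S' ((τ : ℂ) ^ 2) * (2 * τ))), fun τ hτ => ?_⟩
  have hτ' : (τ : ℂ) ≠ 0 := by exact_mod_cast hτ.ne'
  have dpow : ∀ s : ℂ, HasDerivAt (fun x : ℝ => (x : ℂ) ^ s) (s * (τ : ℂ) ^ (s - 1)) τ := fun s => by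
    have := (hasDerivAt_id (τ : ℂ)).cpow_const (c := s) (Or.inl (by simpa using hτ))
    simpa using this.comp_ofReal
  have dsq : HasDerivAt (fun x : ℝ => (x : ℂ) ^ 2) (2 * (τ : ℂ)) τ := by
    have := (hasDerivAt_pow 2 (τ : ℂ)).comp_ofReal
    simpa using this
  have d2 : HasDerivAt (fun x : ℝ => 2 * (x : ℂ)) 2 τ := by
    simpa using ((hasDerivAt_id (τ : ℂ)).const_mul 2).comp_ofReal
  have dSc : HasDerivAt (fun x : ℝ => S ((x : ℂ) ^ 2)) (S' ((τ : ℂ) ^ 2) * (2 * τ)) τ :=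
    (dS _).comp τ dsq
  have dSc' : HasDerivAt (fun x : ℝ => S' ((x : ℂ) ^ 2)) (S'' ((τ : ℂ) ^ 2) * (2 * τ)) τ :=
    (dS' _).comp τ dsq
  constructor
  · refine (((dpow a).mul dSc).const_mul D).congr_of_eventuallyEq ?_
    filter_upwards [lt_mem_nhds hτ] with x hx
    exact sqrt_mul_besselJ hx
  · rw [sqrt_mul_besselJ hτ]
    have := ((((dpow (a - 1)).const_mul a).mul dSc).add ((dpow a).mul (dSc'.mul d2))).const_mul D
    refine this.congr_deriv ?_
    have p1 : (τ : ℂ) ^ a = (τ : ℂ) ^ (a - 1 - 1) * (τ : ℂ) ^ 2 := by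
      rw [← Complex.cpow_natCast, ← Complex.cpow_add _ _ hτ']; congr 1; push_cast; ring
    have p2 : (τ : ℂ) ^ (a - 1) = (τ : ℂ) ^ (a - 1 - 1) * (τ : ℂ) := by
      nth_rewrite 3 [← Complex.cpow_one (τ : ℂ)]
      rw [← Complex.cpow_add _ _ hτ']; congr 1; ring
    rw [p1, p2]
    have o := ode ((τ : ℂ) ^ 2)
    change _ = -(1 + (μ : ℂ) / (τ : ℂ) ^ 2) *
      (D * ((τ : ℂ) ^ (a - 1 - 1) * (τ : ℂ) ^ 2 * S ((τ : ℂ) ^ 2)))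
    simp only [Pi.mul_apply]
    have e : (μ : ℂ) / (τ : ℂ) ^ 2 * (τ : ℂ) ^ 2 = μ := by field_simp
    rw [hμ] at e ⊢
    rw [ha] at *
    generalize (τ : ℂ) ^ (1 / 2 + ν - 1 - 1) = P at *
    generalize S ((τ : ℂ) ^ 2) = s0 at *
    generalize S' ((τ : ℂ) ^ 2) = s1 at *
    generalize S'' ((τ : ℂ) ^ 2) = s2 at *
    linear_combination D * P * s0 * e + 4 * D * P * (τ : ℂ) ^ 2 * o

/-! ### Uniform growth bound for mode solutions -/

theorem hasDerivAt_norm_sq_complex {f : ℝ → ℂ} {f' : ℂ} {t : ℝ} (hf : HasDerivAt f f' t) :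
    HasDerivAt (fun t => ‖f t‖ ^ 2) (2 * (starRingEnd ℂ (f t) * f').re) t := by
  have := hf.norm_sq
  rwa [Complex.inner, mul_comm f'] at this

theorem antitoneOn_Ici_of_hasDerivAt_nonpos {f f' : ℝ → ℝ}
    (hf : ∀ t, 0 ≤ t → HasDerivAt f (f' t) t) (hf' : ∀ t, 0 ≤ t → f' t ≤ 0) :
    AntitoneOn f (Ici 0) := by
  refine antitoneOn_of_hasDerivWithinAt_nonpos (convex_Ici 0)
    (fun t ht => (hf t ht).continuousAt.continuousWithinAt)
    (fun t ht => (hf t (interior_subset ht)).hasDerivWithinAt)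
    (fun t ht => hf' t (interior_subset ht))

/-- `u'' + (1 + b) (1 + t)⁻¹ u' + r² u = 0` with `y = u'`. -/
def IsDampedSolution (b : ℂ) (r : ℝ) (u y : ℝ → ℂ) : Prop :=
  ∀ t : ℝ, 0 ≤ t → HasDerivAt u (y t) t ∧
    HasDerivAt y (-((1 + b) / (1 + t)) * y t - r ^ 2 * u t) t

theorem IsDampedSolution.antitoneOn_energy {b : ℂ} {r : ℝ} {u y : ℝ → ℂ}
    (h : IsDampedSolution b r u y) (hb : 0 ≤ b.re) :
    AntitoneOn (fun t => ‖y t‖ ^ 2 + r ^ 2 * ‖u t‖ ^ 2) (Ici 0) := by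
  refine antitoneOn_Ici_of_hasDerivAt_nonpos (fun t ht =>
    (hasDerivAt_norm_sq_complex (h t ht).2).add
      ((hasDerivAt_norm_sq_complex (h t ht).1).const_mul (r ^ 2))) fun t ht => ?_
  have hx : 0 < 1 + t := by linarith
  have e : 2 * (starRingEnd ℂ (y t) * (-((1 + b) / (1 + t)) * y t - r ^ 2 * u t)).re +
      r ^ 2 * (2 * (starRingEnd ℂ (u t) * y t).re) = -(2 * (1 + b.re) / (1 + t)) * ‖y t‖ ^ 2 := by
    have : ((1 + b) / (1 + t) : ℂ) = ((1 + b) * ((1 / (1 + t) : ℝ) : ℂ)) := by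
      push_cast; ring
    rw [this, Complex.sq_norm, Complex.normSq_apply]
    simp only [← Complex.ofReal_pow, Complex.mul_re, Complex.sub_re, Complex.neg_re,
      Complex.conj_re, Complex.conj_im, Complex.mul_im, Complex.sub_im, Complex.neg_im,
      Complex.ofReal_re, Complex.ofReal_im, Complex.add_re, Complex.add_im, Complex.one_re,
      Complex.one_im]
    ring
  rw [e]
  have : 0 ≤ 2 * (1 + b.re) / (1 + t) * ‖y t‖ ^ 2 := by positivity
  linarith

theorem IsDampedSolution.antitoneOn_exp_mul {b : ℂ} {r : ℝ} {u y : ℝ → ℂ}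
    (h : IsDampedSolution b r u y) (hb : 0 ≤ b.re) (hb0 : b ≠ 0) :
    AntitoneOn (fun t : ℝ => Real.exp (-(2 * r ^ 2 / ‖b‖ * (1 + t) ^ 2)) *
      (‖(1 + t) * y t + b * u t‖ ^ 2 + ‖(1 + t) * y t‖ ^ 2)) (Ici 0) := by
  have dx : ∀ t : ℝ, HasDerivAt (fun t : ℝ => 1 + (t : ℂ)) 1 t := fun t => by
    simpa using ((hasDerivAt_id (t : ℂ)).const_add 1).comp_ofReal
  have dw : ∀ t : ℝ, 0 ≤ t → HasDerivAt (fun t : ℝ => (1 + (t : ℂ)) * y t)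
      (-b * y t - r ^ 2 * (1 + t) * u t) t := fun t ht => by
    have hx : (1 + (t : ℂ)) ≠ 0 := by
      exact_mod_cast (by positivity : (0 : ℝ) < 1 + t).ne'
    refine ((dx t).mul (h t ht).2).congr_deriv ?_
    field_simp
    ring
  have dp : ∀ t : ℝ, 0 ≤ t → HasDerivAt (fun t : ℝ => (1 + (t : ℂ)) * y t + b * u t)
      (-(r ^ 2 * (1 + t) * u t)) t := fun t ht => by
    refine ((dw t ht).add ((h t ht).1.const_mul b)).congr_deriv ?_
    ring
  have dexp : ∀ t : ℝ, HasDerivAt (fun t : ℝ => Real.exp (-(2 * r ^ 2 / ‖b‖ * (1 + t) ^ 2)))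
      (Real.exp (-(2 * r ^ 2 / ‖b‖ * (1 + t) ^ 2)) * -(2 * r ^ 2 / ‖b‖ * (2 * (1 + t)))) t :=
    fun t => by
      have := ((((hasDerivAt_id t).const_add 1).pow 2).const_mul (2 * r ^ 2 / ‖b‖)).neg.exp
      simpa using this
  refine antitoneOn_Ici_of_hasDerivAt_nonpos (fun t ht => (dexp t).mul
    ((hasDerivAt_norm_sq_complex (dp t ht)).add (hasDerivAt_norm_sq_complex (dw t ht))))
    fun t ht => ?_
  have hx : 0 < 1 + t := by linarith
  have hB : 0 < ‖b‖ := norm_pos_iff.2 hb0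
  set w := (1 + (t : ℂ)) * y t with hw
  set p := w + b * u t with hp
  have hu : ‖b‖ * ‖u t‖ ≤ ‖p‖ + ‖w‖ := by
    rw [← norm_mul, show b * u t = p - w by rw [hp]; ring]
    exact norm_sub_le _ _
  have e : 2 * (starRingEnd ℂ p * -(r ^ 2 * (1 + t) * u t)).re +
      2 * (starRingEnd ℂ w * (-b * y t - r ^ 2 * (1 + t) * u t)).re =
      -(2 * r ^ 2 * (1 + t)) * (starRingEnd ℂ (p + w) * u t).re
        - 2 * (1 + t) * b.re * ‖y t‖ ^ 2 := by
    rw [Complex.sq_norm, Complex.normSq_apply, hp, hw]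
    simp only [← Complex.ofReal_pow, Complex.mul_re, Complex.sub_re, Complex.neg_re,
      Complex.conj_re, Complex.conj_im, Complex.mul_im, Complex.sub_im, Complex.neg_im,
      Complex.ofReal_re, Complex.ofReal_im, Complex.add_re, Complex.add_im, Complex.one_re,
      Complex.one_im]
    ring
  have hin : -(starRingEnd ℂ (p + w) * u t).re ≤ (‖p‖ + ‖w‖) * ‖u t‖ := by
    calc _ ≤ |(starRingEnd ℂ (p + w) * u t).re| := neg_le_abs _
      _ ≤ ‖starRingEnd ℂ (p + w) * u t‖ := Complex.abs_re_le_norm _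
      _ = ‖p + w‖ * ‖u t‖ := by rw [norm_mul, Complex.norm_conj]
      _ ≤ _ := by gcongr; exact norm_add_le _ _
  have hmain : 2 * (starRingEnd ℂ p * -(r ^ 2 * (1 + t) * u t)).re +
      2 * (starRingEnd ℂ w * (-b * y t - r ^ 2 * (1 + t) * u t)).re ≤
      2 * r ^ 2 / ‖b‖ * (2 * (1 + t)) * (‖p‖ ^ 2 + ‖w‖ ^ 2) := by
    rw [e]
    have h1 : 0 ≤ 2 * (1 + t) * b.re * ‖y t‖ ^ 2 := by positivity
    have h2 : -(2 * r ^ 2 * (1 + t)) * (starRingEnd ℂ (p + w) * u t).re ≤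
        2 * r ^ 2 * (1 + t) * ((‖p‖ + ‖w‖) * ‖u t‖) := by
      rw [neg_mul, ← mul_neg]
      exact mul_le_mul_of_nonneg_left hin (by positivity)
    have h3 : (‖p‖ + ‖w‖) * ‖u t‖ ≤ 2 * (‖p‖ ^ 2 + ‖w‖ ^ 2) / ‖b‖ := by
      rw [le_div_iff₀ hB]
      nlinarith [sq_nonneg (‖p‖ - ‖w‖), norm_nonneg p, norm_nonneg w]
    have h4 := mul_le_mul_of_nonneg_left h3 (by positivity : 0 ≤ 2 * r ^ 2 * (1 + t))
    have h5 : 2 * r ^ 2 * (1 + t) * (2 * (‖p‖ ^ 2 + ‖w‖ ^ 2) / ‖b‖) =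
      2 * r ^ 2 / ‖b‖ * (2 * (1 + t)) * (‖p‖ ^ 2 + ‖w‖ ^ 2) := by ring
    linarith
  have := Real.exp_pos (-(2 * r ^ 2 / ‖b‖ * (1 + t) ^ 2))
  nlinarith

theorem IsDampedSolution.norm_sq_le {b : ℂ} {r : ℝ} {u y : ℝ → ℂ}
    (h : IsDampedSolution b r u y) (hr : 0 < r) (hb : 0 ≤ b.re) (hb0 : b ≠ 0) {t : ℝ}
    (ht : 0 ≤ t) :
    ‖u t‖ ^ 2 ≤ (1 + (1 + 2 / ‖b‖ ^ 2) * Real.exp (2 / ‖b‖) * ((1 + ‖b‖) ^ 2 + 1)) *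
      (‖u 0‖ + ‖y 0‖) ^ 2 := by
  have hB : 0 < ‖b‖ := norm_pos_iff.2 hb0
  have hen := h.antitoneOn_energy hb
  have hu0 := norm_nonneg (u 0)
  have hy0 := norm_nonneg (y 0)
  set Q := (1 + 2 / ‖b‖ ^ 2) * Real.exp (2 / ‖b‖) * ((1 + ‖b‖) ^ 2 + 1) with hQ
  have hQ0 : 0 ≤ Q := by positivity
  rcases le_total 1 r with h1 | h1
  · have := hen (mem_Ici.2 le_rfl) (mem_Ici.2 ht) ht
    simp only at this
    have hr2 : 1 ≤ r ^ 2 := by nlinarith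
    have h3 : ‖u t‖ ^ 2 ≤ ‖y 0‖ ^ 2 + ‖u 0‖ ^ 2 := by
      by_contra! hcon
      nlinarith [sq_nonneg ‖y t‖, sq_nonneg ‖y 0‖, sq_nonneg ‖u t‖]
    nlinarith [mul_nonneg hQ0 (sq_nonneg (‖u 0‖ + ‖y 0‖)), mul_nonneg hu0 hy0]
  · have hbd : ∀ s : ℝ, 0 ≤ s → r * (1 + s) ≤ 1 →
        ‖(1 + s) * y s + b * u s‖ ^ 2 + ‖(1 + s) * y s‖ ^ 2 ≤
          Real.exp (2 / ‖b‖) * ((1 + ‖b‖) ^ 2 + 1) * (‖u 0‖ + ‖y 0‖) ^ 2 := by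
      intro s hs hrs
      have := h.antitoneOn_exp_mul hb hb0 (mem_Ici.2 le_rfl) (mem_Ici.2 hs) hs
      simp only [Complex.ofReal_zero, add_zero, one_mul] at this
      have e0 : Real.exp (-(2 * r ^ 2 / ‖b‖ * 1 ^ 2)) ≤ 1 := by
        rw [Real.exp_le_one_iff, neg_nonpos]; positivity
      have hrs2 : r ^ 2 * (1 + s) ^ 2 ≤ 1 := by
        rw [← mul_pow]; exact pow_le_one₀ (by positivity) hrs
      have e1 : Real.exp (-(2 / ‖b‖)) ≤ Real.exp (-(2 * r ^ 2 / ‖b‖ * (1 + s) ^ 2)) := by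
        rw [Real.exp_le_exp, neg_le_neg_iff,
          show 2 * r ^ 2 / ‖b‖ * (1 + s) ^ 2 = 2 * (r ^ 2 * (1 + s) ^ 2) / ‖b‖ by ring]
        gcongr
        linarith
      set Φ := ‖(1 + s) * y s + b * u s‖ ^ 2 + ‖(1 + s) * y s‖ ^ 2 with hΦ
      have hΦ0 : 0 ≤ Φ := by positivity
      have i1 : ‖y 0 + b * u 0‖ ^ 2 + ‖y 0‖ ^ 2 ≤
          ((1 + ‖b‖) ^ 2 + 1) * (‖u 0‖ + ‖y 0‖) ^ 2 := by
        have n1 : ‖y 0 + b * u 0‖ ≤ (1 + ‖b‖) * (‖u 0‖ + ‖y 0‖) := by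
          refine (norm_add_le _ _).trans ?_
          rw [norm_mul]
          nlinarith [mul_nonneg hB.le hy0]
        have n2 := pow_le_pow_left₀ (norm_nonneg _) n1 2
        have n3 := pow_le_pow_left₀ hy0 (le_add_of_nonneg_left hu0 : ‖y 0‖ ≤ ‖u 0‖ + ‖y 0‖) 2
        rw [mul_pow] at n2
        linarith
      have i2 : Real.exp (-(2 / ‖b‖)) * Φ ≤ ((1 + ‖b‖) ^ 2 + 1) * (‖u 0‖ + ‖y 0‖) ^ 2 :=
        calc _ ≤ Real.exp (-(2 * r ^ 2 / ‖b‖ * (1 + s) ^ 2)) * Φ := by gcongr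
          _ ≤ _ := this
          _ ≤ 1 * (‖y 0 + b * u 0‖ ^ 2 + ‖y 0‖ ^ 2) := by gcongr
          _ ≤ _ := by rw [one_mul]; exact i1
      calc Φ = Real.exp (2 / ‖b‖) * (Real.exp (-(2 / ‖b‖)) * Φ) := by
            rw [← mul_assoc, ← Real.exp_add]; simp
        _ ≤ Real.exp (2 / ‖b‖) * (((1 + ‖b‖) ^ 2 + 1) * (‖u 0‖ + ‖y 0‖) ^ 2) := by gcongr
        _ = _ := by ring
    have hu : ∀ s : ℝ, 0 ≤ s → ‖u s‖ ^ 2 ≤ 2 / ‖b‖ ^ 2 *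
        (‖(1 + s) * y s + b * u s‖ ^ 2 + ‖(1 + s) * y s‖ ^ 2) := by
      intro s _
      have hn : ‖b‖ * ‖u s‖ ≤ ‖(1 + s) * y s + b * u s‖ + ‖(1 + s) * y s‖ := by
        rw [← norm_mul]
        simpa using norm_sub_le ((1 + s) * y s + b * u s) ((1 + s) * y s)
      have h2 := pow_le_pow_left₀ (by positivity) hn 2
      rw [div_mul_eq_mul_div, le_div_iff₀ (by positivity)]
      rw [mul_pow] at h2
      nlinarith [sq_nonneg (‖(1 + s) * y s + b * u s‖ - ‖(1 + s) * y s‖)]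
    have hfin : ‖u t‖ ^ 2 ≤ Q * (‖u 0‖ + ‖y 0‖) ^ 2 := by
      rcases le_total (r * (1 + t)) 1 with h2 | h2
      · have hb1 := hbd t ht h2
        have hΦ0 : 0 ≤ ‖(1 + t) * y t + b * u t‖ ^ 2 + ‖(1 + t) * y t‖ ^ 2 := by positivity
        calc _ ≤ _ := hu t ht
          _ ≤ (1 + 2 / ‖b‖ ^ 2) *
            (‖(1 + t) * y t + b * u t‖ ^ 2 + ‖(1 + t) * y t‖ ^ 2) := by gcongr; linarith
          _ ≤ (1 + 2 / ‖b‖ ^ 2) *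
            (Real.exp (2 / ‖b‖) * ((1 + ‖b‖) ^ 2 + 1) * (‖u 0‖ + ‖y 0‖) ^ 2) := by gcongr
          _ = _ := by rw [hQ]; ring
      · set T := 1 / r - 1 with hT
        have hT1 : 1 + T = 1 / r := by rw [hT]; ring
        have hT0 : 0 ≤ T := by
          rw [hT, sub_nonneg, le_div_iff₀ hr]; linarith
        have hTt : T ≤ t := by
          have : 1 / r ≤ 1 + t := by rw [div_le_iff₀ hr]; linarith
          linarith
        have hb1 := hbd T hT0 (by rw [hT1]; field_simp; rfl)
        have hb2 := hu T hT0
        have hE := hen (mem_Ici.2 hT0) (mem_Ici.2 ht) hTt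
        simp only at hE
        have hw : ‖(1 + T) * y T‖ ^ 2 = ‖y T‖ ^ 2 / r ^ 2 := by
          have : (1 + (T : ℂ)) = ((1 / r : ℝ) : ℂ) := by rw [← hT1]; push_cast; rfl
          rw [this, norm_mul, Complex.norm_real, Real.norm_of_nonneg (by positivity)]
          field_simp
        set Φ := ‖(1 + T) * y T + b * u T‖ ^ 2 + ‖(1 + T) * y T‖ ^ 2 with hΦ
        have hwΦ : ‖y T‖ ^ 2 / r ^ 2 ≤ Φ := by
          rw [← hw, hΦ]; linarith [sq_nonneg ‖(1 + T) * y T + b * u T‖]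
        have hEu : ‖u t‖ ^ 2 ≤ ‖y T‖ ^ 2 / r ^ 2 + ‖u T‖ ^ 2 := by
          have e : r ^ 2 * (‖y T‖ ^ 2 / r ^ 2 + ‖u T‖ ^ 2) = ‖y T‖ ^ 2 + r ^ 2 * ‖u T‖ ^ 2 := by
            field_simp
          have hr2 : 0 < r ^ 2 := by positivity
          refine le_of_mul_le_mul_left ?_ hr2
          rw [e]
          linarith [sq_nonneg ‖y t‖]
        calc _ ≤ _ := hEu
          _ ≤ (1 + 2 / ‖b‖ ^ 2) * Φ := by linarith
          _ ≤ (1 + 2 / ‖b‖ ^ 2) *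
            (Real.exp (2 / ‖b‖) * ((1 + ‖b‖) ^ 2 + 1) * (‖u 0‖ + ‖y 0‖) ^ 2) := by gcongr
          _ = _ := by rw [hQ]; ring
    nlinarith [sq_nonneg (‖u 0‖ + ‖y 0‖)]

theorem exists_isModeSolution_norm_le {ν : ℂ} {μ : ℝ} (hμ : (μ : ℂ) = 1 / 4 - ν ^ 2)
    (hν : 0 ≤ ν.re) (hν0 : ν ≠ 0) :
    ∃ C > (0 : ℝ), ∀ r : ℝ, 0 < r → ∀ v v' : ℝ → ℂ, IsModeSolution μ r v v' → ∀ t, 0 ≤ t →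
      ‖v t‖ ≤ C * (1 + t) ^ (1 / 2 + ν.re) * (‖v 0‖ + ‖v' 0‖) := by
  set b := 2 * ν with hb
  set a := 1 / 2 + ν with ha
  have hb0 : b ≠ 0 := by simpa [hb] using hν0
  have hbre : 0 ≤ b.re := by simpa [hb] using hν
  set K := 1 + (1 + 2 / ‖b‖ ^ 2) * Real.exp (2 / ‖b‖) * ((1 + ‖b‖) ^ 2 + 1) with hK
  have hK0 : 0 < K := by positivity
  refine ⟨Real.sqrt K * (1 + ‖a‖), by positivity, fun r hr v v' h t ht => ?_⟩
  set u : ℝ → ℂ := fun t => (1 + (t : ℂ)) ^ (-a) * v t with hu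
  set y : ℝ → ℂ := fun t => (1 + (t : ℂ)) ^ (-a) * v' t - a * (1 + (t : ℂ)) ^ (-a - 1) * v t with hy
  have hsol : IsDampedSolution b r u y := by
    intro t ht
    have hx : (0 : ℝ) < 1 + t := by linarith
    have hx' : (1 + (t : ℂ)) ≠ 0 := by exact_mod_cast hx.ne'
    have dpow : ∀ s : ℂ, HasDerivAt (fun x : ℝ => (1 + (x : ℂ)) ^ s)
        (s * (1 + (t : ℂ)) ^ (s - 1)) t := fun s => by
      have := ((hasDerivAt_id (t : ℂ)).const_add 1).cpow_const (c := s)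
        (Or.inl (by simpa using hx))
      simpa using this.comp_ofReal
    obtain ⟨h1, h2⟩ := h t (by linarith)
    constructor
    · refine ((dpow (-a)).mul h1).congr_deriv ?_
      simp only [hy]; ring
    · have := ((dpow (-a)).mul h2).sub (((dpow (-a - 1)).const_mul a).mul h1)
      refine this.congr_deriv ?_
      simp only [hu, hy]
      have p1 : (1 + (t : ℂ)) ^ (-a) = (1 + (t : ℂ)) ^ (-a - 1 - 1) * (1 + (t : ℂ)) ^ 2 := by
        rw [← Complex.cpow_natCast, ← Complex.cpow_add _ _ hx']; congr 1; push_cast; ring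
      have p2 : (1 + (t : ℂ)) ^ (-a - 1) = (1 + (t : ℂ)) ^ (-a - 1 - 1) * (1 + (t : ℂ)) := by
        nth_rewrite 3 [← Complex.cpow_one (1 + (t : ℂ))]
        rw [← Complex.cpow_add _ _ hx']; congr 1; ring
      rw [p1, p2]
      push_cast
      rw [hμ]
      generalize (1 + (t : ℂ)) ^ (-a - 1 - 1) = P
      rw [hb, ha]
      field_simp
      ring
  have hbd := hsol.norm_sq_le hr hbre hb0 ht
  have hx : (0 : ℝ) < 1 + t := by linarith
  have hn : ‖u t‖ = (1 + t) ^ (-(1 / 2 + ν.re)) * ‖v t‖ := by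
    simp only [hu, norm_mul]
    congr 1
    rw [show (1 + (t : ℂ)) = ((1 + t : ℝ) : ℂ) by push_cast; rfl,
      Complex.norm_cpow_eq_rpow_re_of_pos hx]
    simp [ha]
  have hu0 : u 0 = v 0 := by simp [hu]
  have hy0 : ‖y 0‖ ≤ ‖v' 0‖ + ‖a‖ * ‖v 0‖ := by
    simp only [hy, Complex.ofReal_zero, add_zero, Complex.one_cpow, one_mul, mul_one]
    exact (norm_sub_le _ _).trans (by rw [norm_mul])
  have h1 : ‖u t‖ ≤ Real.sqrt K * (‖u 0‖ + ‖y 0‖) := by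
    refine (sq_le_sq₀ (norm_nonneg _) (by positivity)).1 ?_
    rwa [mul_pow, Real.sq_sqrt hK0.le]
  have h2 : ‖u 0‖ + ‖y 0‖ ≤ (1 + ‖a‖) * (‖v 0‖ + ‖v' 0‖) := by
    rw [hu0]
    nlinarith [norm_nonneg a, norm_nonneg (v' 0), mul_nonneg (norm_nonneg a) (norm_nonneg (v' 0))]
  calc ‖v t‖ = (1 + t) ^ (1 / 2 + ν.re) * ‖u t‖ := by
        rw [hn, ← mul_assoc, ← Real.rpow_add hx]; simp
    _ ≤ (1 + t) ^ (1 / 2 + ν.re) * (Real.sqrt K * ((1 + ‖a‖) * (‖v 0‖ + ‖v' 0‖))) := by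
        gcongr
        exact h1.trans (by gcongr)
    _ = _ := by ring

/-! ### Convergence with a rate -/

theorem exists_tendsto_norm_sub_le_of_norm_deriv_le {h h' : ℝ → ℂ} {D σ : ℝ} (hσ : σ < 1)
    (hD : 0 ≤ D) (hd : ∀ t, 0 ≤ t → HasDerivAt h (h' t) t)
    (hb : ∀ t, 0 ≤ t → ‖h' t‖ ≤ D * (1 + t) ^ (σ - 2)) :
    ∃ l : ℂ, Filter.Tendsto (fun n : ℕ => h n) Filter.atTop (nhds l) ∧
      ∀ t, 0 ≤ t → ‖h t - l‖ ≤ D / (1 - σ) * (1 + t) ^ (σ - 1) := by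
  have h1σ : 0 < 1 - σ := by linarith
  have key : ∀ s t : ℝ, 0 ≤ s → s ≤ t → ‖h t - h s‖ ≤ D / (1 - σ) * (1 + s) ^ (σ - 1) := by
    intro s t hs hst
    have dB : ∀ x : ℝ, 0 ≤ x → HasDerivAt
        (fun x : ℝ => D / (1 - σ) * ((1 + s) ^ (σ - 1) - (1 + x) ^ (σ - 1)))
        (D * (1 + x) ^ (σ - 2)) x := by
      intro x hx
      have h1 : (1 + x) ≠ 0 := by positivity
      have := (((((hasDerivAt_id x).const_add 1).rpow_const (p := σ - 1) (Or.inl h1)).const_sub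
        ((1 + s) ^ (σ - 1))).const_mul (D / (1 - σ)))
      refine this.congr_deriv ?_
      rw [show σ - 1 - 1 = σ - 2 by ring]
      simp only [id]
      field_simp
      ring
    have hseg := image_norm_le_of_norm_deriv_right_le_deriv_boundary' (a := s) (b := t)
      (f := fun x => h x - h s) (f' := h')
      (B := fun x : ℝ => D / (1 - σ) * ((1 + s) ^ (σ - 1) - (1 + x) ^ (σ - 1)))
      (B' := fun x : ℝ => D * (1 + x) ^ (σ - 2))
      (fun x hx => ((hd x (hs.trans hx.1)).sub_const _).continuousAt.continuousWithinAt)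
      (fun x hx => ((hd x (hs.trans hx.1)).sub_const _).hasDerivWithinAt)
      (by simp)
      (fun x hx => (dB x (hs.trans hx.1)).continuousAt.continuousWithinAt)
      (fun x hx => (dB x (hs.trans hx.1)).hasDerivWithinAt)
      (fun x hx => hb x (hs.trans hx.1))
    refine (hseg (right_mem_Icc.2 hst)).trans ?_
    have : 0 ≤ (1 + t) ^ (σ - 1) := by have := hs.trans hst; positivity
    gcongr
    linarith
  have hlim : Filter.Tendsto (fun n : ℕ => D / (1 - σ) * (1 + (n : ℝ)) ^ (σ - 1))
      Filter.atTop (nhds 0) := by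
    have h1 : Filter.Tendsto (fun n : ℕ => 1 + (n : ℝ)) Filter.atTop Filter.atTop :=
      Filter.tendsto_atTop_add_const_left _ _ tendsto_natCast_atTop_atTop
    have h2 := ((tendsto_rpow_neg_atTop h1σ).comp h1).const_mul (D / (1 - σ))
    rw [mul_zero] at h2
    refine h2.congr fun n => ?_
    simp
  have hc : CauchySeq fun n : ℕ => h n :=
    cauchySeq_of_le_tendsto_0' _ (fun n m hnm => by
      rw [dist_comm, dist_eq_norm]
      exact key n m n.cast_nonneg (by exact_mod_cast hnm)) hlim
  obtain ⟨l, hl⟩ := cauchySeq_tendsto_of_complete hc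
  refine ⟨l, hl, fun t ht => ?_⟩
  rw [norm_sub_rev]
  refine le_of_tendsto ((hl.sub_const (h t)).norm) ?_
  filter_upwards [Filter.eventually_ge_atTop ⌈t⌉₊] with n hn
  exact key t n ht (Nat.ceil_le.1 hn)

/-! ### The propagator multipliers as mode solutions -/

namespace IsModeSolution

variable {μ r : ℝ} {v v' w w' : ℝ → ℂ}

theorem to_deriv (h : IsModeSolution μ r v v') : IsModeSolution μ r v (deriv v) := by
  intro t ht
  have e : ∀ s : ℝ, -1 < s → deriv v s = v' s := fun s hs => (h s hs).1.deriv
  refine ⟨by rw [e t ht]; exact (h t ht).1, (h t ht).2.congr_of_eventuallyEq ?_⟩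
  filter_upwards [lt_mem_nhds ht] with s hs using e s hs

theorem linear_combination (hv : IsModeSolution μ r v v') (hw : IsModeSolution μ r w w')
    (a b : ℂ) :
    IsModeSolution μ r (fun t => a * v t + b * w t) (fun t => a * v' t + b * w' t) := by
  intro t ht
  refine ⟨((hv t ht).1.const_mul a).add ((hw t ht).1.const_mul b),
    (((hv t ht).2.const_mul a).add ((hw t ht).2.const_mul b)).congr_deriv ?_⟩
  ring

/-- The coefficient of `r⁻¹ · cos` in the free wave matching `v` at time `t` converges. -/
theorem exists_tendsto_cos_coeff (hv : IsModeSolution μ r v v') {B σ : ℝ} (hμ : 0 ≤ μ) (hB : 0 ≤ B)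
    (hσ : σ < 1) (hb : ∀ t, 0 ≤ t → ‖v t‖ ≤ B * (1 + t) ^ σ) :
    ∃ l : ℂ, Filter.Tendsto (fun n : ℕ => (r : ℂ) * Complex.cos ((n : ℝ) * r) * v n -
        Complex.sin ((n : ℝ) * r) * v' n) Filter.atTop (nhds l) ∧
      ∀ t : ℝ, 0 ≤ t → ‖(r : ℂ) * Complex.cos (t * r) * v t - Complex.sin (t * r) * v' t - l‖ ≤
        μ * B / (1 - σ) * (1 + t) ^ (σ - 1) := by
  refine exists_tendsto_norm_sub_le_of_norm_deriv_le
    (h := fun t : ℝ => (r : ℂ) * Complex.cos (t * r) * v t - Complex.sin (t * r) * v' t)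
    (h' := fun t : ℝ => Complex.sin (t * r) * ((μ / (1 + t) ^ 2 : ℝ) * v t))
    hσ (by positivity) (fun t ht => ?_) (fun t ht => ?_)
  · obtain ⟨h1, h2⟩ := hv t (by linarith)
    have dl : HasDerivAt (fun t : ℝ => (t : ℂ) * r) r t := by
      simpa using ((hasDerivAt_id (t : ℂ)).mul_const (r : ℂ)).comp_ofReal
    have dc := (Complex.hasDerivAt_cos ((t : ℂ) * r)).comp t dl
    have ds := (Complex.hasDerivAt_sin ((t : ℂ) * r)).comp t dl
    refine (((dc.const_mul (r : ℂ)).mul h1).sub (ds.mul h2)).congr_deriv ?_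
    simp only [Function.comp_apply]
    push_cast
    ring
  · have hx : 0 < 1 + t := by linarith
    rw [← Complex.ofReal_mul, ← Complex.ofReal_sin, norm_mul, norm_mul, Complex.norm_real,
      Complex.norm_real, Real.norm_of_nonneg (by positivity : 0 ≤ μ / (1 + t) ^ 2)]
    calc ‖Real.sin (t * r)‖ * (μ / (1 + t) ^ 2 * ‖v t‖)
        ≤ 1 * (μ / (1 + t) ^ 2 * (B * (1 + t) ^ σ)) := by
          gcongr
          · exact Real.abs_sin_le_one _
          · exact hb t ht
      _ = μ * B * (1 + t) ^ (σ - 2) := by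
          rw [Real.rpow_sub hx, Real.rpow_two]; ring

/-- The coefficient of `r⁻¹ · sin` in the free wave matching `v` at time `t` converges. -/
theorem exists_tendsto_sin_coeff (hv : IsModeSolution μ r v v') {B σ : ℝ} (hμ : 0 ≤ μ) (hB : 0 ≤ B)
    (hσ : σ < 1) (hb : ∀ t, 0 ≤ t → ‖v t‖ ≤ B * (1 + t) ^ σ) :
    ∃ l : ℂ, Filter.Tendsto (fun n : ℕ => (r : ℂ) * Complex.sin ((n : ℝ) * r) * v n +
        Complex.cos ((n : ℝ) * r) * v' n) Filter.atTop (nhds l) ∧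
      ∀ t : ℝ, 0 ≤ t → ‖(r : ℂ) * Complex.sin (t * r) * v t + Complex.cos (t * r) * v' t - l‖ ≤
        μ * B / (1 - σ) * (1 + t) ^ (σ - 1) := by
  refine exists_tendsto_norm_sub_le_of_norm_deriv_le
    (h := fun t : ℝ => (r : ℂ) * Complex.sin (t * r) * v t + Complex.cos (t * r) * v' t)
    (h' := fun t : ℝ => -Complex.cos (t * r) * ((μ / (1 + t) ^ 2 : ℝ) * v t))
    hσ (by positivity) (fun t ht => ?_) (fun t ht => ?_)
  · obtain ⟨h1, h2⟩ := hv t (by linarith)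
    have dl : HasDerivAt (fun t : ℝ => (t : ℂ) * r) r t := by
      simpa using ((hasDerivAt_id (t : ℂ)).mul_const (r : ℂ)).comp_ofReal
    have dc := (Complex.hasDerivAt_cos ((t : ℂ) * r)).comp t dl
    have ds := (Complex.hasDerivAt_sin ((t : ℂ) * r)).comp t dl
    refine (((ds.const_mul (r : ℂ)).mul h1).add (dc.mul h2)).congr_deriv ?_
    simp only [Function.comp_apply]
    push_cast
    ring
  · have hx : 0 < 1 + t := by linarith
    rw [← Complex.ofReal_mul, ← Complex.ofReal_cos, norm_mul, norm_mul, norm_neg,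
      Complex.norm_real, Complex.norm_real,
      Real.norm_of_nonneg (by positivity : 0 ≤ μ / (1 + t) ^ 2)]
    calc ‖Real.cos (t * r)‖ * (μ / (1 + t) ^ 2 * ‖v t‖)
        ≤ 1 * (μ / (1 + t) ^ 2 * (B * (1 + t) ^ σ)) := by
          gcongr
          · exact Real.abs_cos_le_one _
          · exact hb t ht
      _ = μ * B * (1 + t) ^ (σ - 2) := by
          rw [Real.rpow_sub hx, Real.rpow_two]; ring

end IsModeSolution

theorem isModeSolution_ePlus {ν : ℂ} {μ r : ℝ} (hν : -(1 / 2) ≤ ν.re)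
    (hμ : (μ : ℂ) = 1 / 4 - ν ^ 2) (hr : 0 < r) :
    IsModeSolution μ r (ePlus ν r) (ePlusDot ν r) := by
  obtain ⟨f', hf'⟩ := exists_hasDerivAt_sqrt_mul_besselJ hν hμ
  have : IsModeSolution μ r (ePlus ν r) (fun t => r * f' ((1 + t) * r)) := by
    intro t ht
    have hx : 0 < 1 + t := by linarith
    obtain ⟨h1, h2⟩ := hf' ((1 + t) * r) (by positivity)
    have dl : HasDerivAt (fun t : ℝ => (1 + t) * r) r t := by
      simpa using ((hasDerivAt_id t).const_add 1).mul_const r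
    have e1 : HasDerivAt (ePlus ν r) (r • f' ((1 + t) * r)) t :=
      HasDerivAt.scomp (h := fun t : ℝ => (1 + t) * r) t h1 dl
    refine ⟨by simpa using e1, ((h2.scomp t dl).const_mul (r : ℂ)).congr_deriv ?_⟩
    have hr' : (r : ℂ) ≠ 0 := by exact_mod_cast hr.ne'
    have hx' : (1 + (t : ℂ)) ≠ 0 := by exact_mod_cast hx.ne'
    simp only [ePlus, Complex.real_smul]
    push_cast
    field_simp
  exact this.to_deriv

theorem eMinus_eq (ν : ℂ) (r : ℝ) :
    eMinus ν r = fun t => Complex.cos (ν * π) / Complex.sin (ν * π) * ePlus ν r t +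
      -1 / Complex.sin (ν * π) * ePlus (-ν) r t := by
  funext t
  simp only [eMinus, ePlus, besselY]
  ring

theorem isModeSolution_eMinus {ν : ℂ} {μ r : ℝ} (hν : -(1 / 2) ≤ ν.re) (hν' : ν.re ≤ 1 / 2)
    (hμ : (μ : ℂ) = 1 / 4 - ν ^ 2) (hr : 0 < r) :
    IsModeSolution μ r (eMinus ν r) (eMinusDot ν r) := by
  have h1 := isModeSolution_ePlus hν hμ hr
  have h2 : IsModeSolution μ r (ePlus (-ν) r) (ePlusDot (-ν) r) :=
    isModeSolution_ePlus (by simpa using hν') (by simpa using hμ) hr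
  have := h1.linear_combination h2 (Complex.cos (ν * π) / Complex.sin (ν * π))
    (-1 / Complex.sin (ν * π))
  rw [← eMinus_eq] at this
  exact this.to_deriv

theorem ePlus_zero (ν : ℂ) : ePlus ν 0 = fun _ => 0 := by
  funext t; simp [ePlus]

theorem eMinus_zero (ν : ℂ) : eMinus ν 0 = fun _ => 0 := by
  funext t; simp [eMinus]

theorem hasDerivAt_ePlus_eMinus {ν : ℂ} {μ r t : ℝ} (hν : -(1 / 2) ≤ ν.re) (hν' : ν.re ≤ 1 / 2)
    (hμ : (μ : ℂ) = 1 / 4 - ν ^ 2) (hr : 0 ≤ r) (ht : -1 < t) :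
    HasDerivAt (ePlus ν r) (ePlusDot ν r t) t ∧ HasDerivAt (eMinus ν r) (eMinusDot ν r t) t := by
  rcases hr.eq_or_lt with rfl | hr
  · rw [ePlusDot, eMinusDot, ePlus_zero, eMinus_zero]
    simpa using hasDerivAt_const t (0 : ℂ)
  · exact ⟨(isModeSolution_ePlus hν hμ hr t ht).1, (isModeSolution_eMinus hν hν' hμ hr t ht).1⟩

/-- The Wronskian of `e₊` and `e₋` at time `t₀`. -/
def modeWronskian (ν : ℂ) (r t₀ : ℝ) : ℂ :=
  ePlus ν r t₀ * eMinusDot ν r t₀ - ePlusDot ν r t₀ * eMinus ν r t₀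

theorem E0_eq (ν : ℂ) (r t₀ : ℝ) :
    (fun t => E0 ν r t t₀) = fun t => eMinusDot ν r t₀ / modeWronskian ν r t₀ * ePlus ν r t +
      -ePlusDot ν r t₀ / modeWronskian ν r t₀ * eMinus ν r t := by
  funext t
  simp only [E0, modeWronskian]
  ring

theorem E1_eq (ν : ℂ) (r t₀ : ℝ) :
    (fun t => E1 ν r t t₀) = fun t => -eMinus ν r t₀ / modeWronskian ν r t₀ * ePlus ν r t +
      ePlus ν r t₀ / modeWronskian ν r t₀ * eMinus ν r t := by
  funext t
  simp only [E1, modeWronskian]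
  ring

theorem E0dot_eq {ν : ℂ} {μ r t : ℝ} (t₀ : ℝ) (hν : -(1 / 2) ≤ ν.re) (hν' : ν.re ≤ 1 / 2)
    (hμ : (μ : ℂ) = 1 / 4 - ν ^ 2) (hr : 0 ≤ r) (ht : -1 < t) :
    E0dot ν r t t₀ = eMinusDot ν r t₀ / modeWronskian ν r t₀ * ePlusDot ν r t +
      -ePlusDot ν r t₀ / modeWronskian ν r t₀ * eMinusDot ν r t := by
  obtain ⟨h1, h2⟩ := hasDerivAt_ePlus_eMinus hν hν' hμ hr ht
  rw [E0dot, E0_eq]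
  exact ((h1.const_mul _).add (h2.const_mul _)).deriv

theorem E1dot_eq {ν : ℂ} {μ r t : ℝ} (t₀ : ℝ) (hν : -(1 / 2) ≤ ν.re) (hν' : ν.re ≤ 1 / 2)
    (hμ : (μ : ℂ) = 1 / 4 - ν ^ 2) (hr : 0 ≤ r) (ht : -1 < t) :
    E1dot ν r t t₀ = -eMinus ν r t₀ / modeWronskian ν r t₀ * ePlusDot ν r t +
      ePlus ν r t₀ / modeWronskian ν r t₀ * eMinusDot ν r t := by
  obtain ⟨h1, h2⟩ := hasDerivAt_ePlus_eMinus hν hν' hμ hr ht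
  rw [E1dot, E1_eq]
  exact ((h1.const_mul _).add (h2.const_mul _)).deriv

theorem isModeSolution_propagator {ν : ℂ} {μ r : ℝ} (t₀ : ℝ) (hν : -(1 / 2) ≤ ν.re)
    (hν' : ν.re ≤ 1 / 2) (hμ : (μ : ℂ) = 1 / 4 - ν ^ 2) (hr : 0 < r) (z₀ z₁ : ℂ) :
    IsModeSolution μ r (fun t => E0 ν r t t₀ * z₀ + E1 ν r t t₀ * z₁)
      (fun t => E0dot ν r t t₀ * z₀ + E1dot ν r t t₀ * z₁) := by
  have hp := isModeSolution_ePlus hν hμ hr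
  have hm := isModeSolution_eMinus hν hν' hμ hr
  have h0 := (hp.linear_combination hm (eMinusDot ν r t₀ / modeWronskian ν r t₀)
    (-ePlusDot ν r t₀ / modeWronskian ν r t₀)).to_deriv
  have h1 := (hp.linear_combination hm (-eMinus ν r t₀ / modeWronskian ν r t₀)
    (ePlus ν r t₀ / modeWronskian ν r t₀)).to_deriv
  rw [← E0_eq] at h0
  rw [← E1_eq] at h1
  have := h0.linear_combination h1 z₀ z₁
  simpa only [E0dot, E1dot, mul_comm] using this

theorem norm_propagator_initial_le {ν : ℂ} {μ r t₀ : ℝ} (hν : -(1 / 2) ≤ ν.re)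
    (hν' : ν.re ≤ 1 / 2) (hμ : (μ : ℂ) = 1 / 4 - ν ^ 2) (hr : 0 ≤ r) (ht : -1 < t₀) (z₀ z₁ : ℂ) :
    ‖E0 ν r t₀ t₀ * z₀ + E1 ν r t₀ t₀ * z₁‖ ≤ ‖z₀‖ ∧
      ‖E0dot ν r t₀ t₀ * z₀ + E1dot ν r t₀ t₀ * z₁‖ ≤ ‖z₁‖ := by
  have e1 : E1 ν r t₀ t₀ = 0 := by simp [E1, mul_comm]
  have e2 : E0dot ν r t₀ t₀ = 0 := by rw [E0dot_eq t₀ hν hν' hμ hr ht]; ring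
  have e3 : E0 ν r t₀ t₀ = modeWronskian ν r t₀ / modeWronskian ν r t₀ := rfl
  have e4 : E1dot ν r t₀ t₀ = modeWronskian ν r t₀ / modeWronskian ν r t₀ := by
    rw [E1dot_eq t₀ hν hν' hμ hr ht]
    nth_rewrite 3 [modeWronskian]
    ring
  rw [e1, e2, e3, e4]
  by_cases h : modeWronskian ν r t₀ = 0
  · simp [h]
  · simp [div_self h]

/-! ### Measurability in the frequency variable -/

theorem measurable_sqrt_mul_besselJ {ν : ℂ} {μ : ℝ} (hν : -(1 / 2) ≤ ν.re)
    (hμ : (μ : ℂ) = 1 / 4 - ν ^ 2) :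
    Measurable fun τ : ℝ => (Real.sqrt τ : ℂ) * besselJ ν τ := by
  obtain ⟨f', hf'⟩ := exists_hasDerivAt_sqrt_mul_besselJ hν hμ
  classical
  have hm := ContinuousOn.measurable_piecewise (s := Ioi (0 : ℝ))
    (f := fun τ : ℝ => (Real.sqrt τ : ℂ) * besselJ ν τ) (g := fun _ => 0)
    (fun τ hτ => (hf' τ hτ).1.continuousAt.continuousWithinAt) continuousOn_const measurableSet_Ioi
  convert hm using 1
  funext τ
  by_cases hτ : τ ∈ Ioi (0 : ℝ)
  · rw [piecewise_eq_of_mem _ _ _ hτ]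
  · rw [piecewise_eq_of_notMem _ _ _ hτ, Real.sqrt_eq_zero_of_nonpos (not_lt.1 hτ)]
    simp

theorem measurable_deriv_comp_one_add_mul (F : ℝ → ℂ) (t : ℝ) :
    Measurable fun r : ℝ => deriv (fun s : ℝ => F ((1 + s) * r)) t := by
  have e : (fun r : ℝ => deriv (fun s : ℝ => F ((1 + s) * r)) t) =
      fun r : ℝ => (r : ℂ) * deriv F (r * (1 + t)) := by
    funext r
    have h1 := deriv_comp_const_add (f := fun x : ℝ => F (r * x)) 1 t
    have h2 := deriv_comp_mul_left r F (1 + t)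
    rw [h2, Complex.real_smul] at h1
    rw [← h1]
    simp only [mul_comm r]
  rw [e]
  exact Complex.measurable_ofReal.mul
    ((measurable_deriv F).comp (measurable_id.mul_const (1 + t)))

section

variable {ν : ℂ} {μ : ℝ}

theorem measurable_ePlus (hν : -(1 / 2) ≤ ν.re) (hμ : (μ : ℂ) = 1 / 4 - ν ^ 2) (t : ℝ) :
    Measurable fun r => ePlus ν r t :=
  (measurable_sqrt_mul_besselJ hν hμ).comp (measurable_id.const_mul (1 + t))

theorem measurable_ePlusDot (ν : ℂ) (t : ℝ) : Measurable fun r => ePlusDot ν r t :=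
  measurable_deriv_comp_one_add_mul (fun τ => (Real.sqrt τ : ℂ) * besselJ ν τ) t

theorem measurable_eMinusDot (ν : ℂ) (t : ℝ) : Measurable fun r => eMinusDot ν r t :=
  measurable_deriv_comp_one_add_mul (fun τ => (Real.sqrt τ : ℂ) * besselY ν τ) t

theorem measurable_eMinus (hν : -(1 / 2) ≤ ν.re) (hν' : ν.re ≤ 1 / 2)
    (hμ : (μ : ℂ) = 1 / 4 - ν ^ 2) (t : ℝ) : Measurable fun r => eMinus ν r t := by
  simp only [eMinus_eq]
  exact ((measurable_ePlus hν hμ t).const_mul _).add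
    ((measurable_ePlus (by simpa using hν') (by simpa using hμ) t).const_mul _)

theorem measurable_propagator (hν : -(1 / 2) ≤ ν.re) (hν' : ν.re ≤ 1 / 2)
    (hμ : (μ : ℂ) = 1 / 4 - ν ^ 2) (t t₀ : ℝ) :
    (Measurable fun r => E0 ν r t t₀) ∧ Measurable fun r => E1 ν r t t₀ := by
  have p := measurable_ePlus hν hμ
  have m := measurable_eMinus hν hν' hμ
  have dp := measurable_ePlusDot ν
  have dm := measurable_eMinusDot ν
  have w := ((p t₀).mul (dm t₀)).sub ((dp t₀).mul (m t₀))
  exact ⟨(((p t).mul (dm t₀)).sub ((dp t₀).mul (m t))).div w,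
    (((p t₀).mul (m t)).sub ((p t).mul (m t₀))).div w⟩

theorem measurable_propagatorDot {α : Type*} [MeasurableSpace α] (hν : -(1 / 2) ≤ ν.re)
    (hν' : ν.re ≤ 1 / 2) (hμ : (μ : ℂ) = 1 / 4 - ν ^ 2) {t : ℝ} (ht : -1 < t) (t₀ : ℝ)
    {ρ : α → ℝ} (hρ : Measurable ρ) (hρ0 : ∀ x, 0 ≤ ρ x) :
    (Measurable fun x => E0dot ν (ρ x) t t₀) ∧ Measurable fun x => E1dot ν (ρ x) t t₀ := by
  have p := measurable_ePlus hν hμ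
  have m := measurable_eMinus hν hν' hμ
  have dp := measurable_ePlusDot ν
  have dm := measurable_eMinusDot ν
  have w : Measurable fun r => modeWronskian ν r t₀ :=
    ((p t₀).mul (dm t₀)).sub ((dp t₀).mul (m t₀))
  constructor
  · simp only [fun x => E0dot_eq t₀ hν hν' hμ (hρ0 x) ht]
    exact (((((dm t₀).div w).mul (dp t)).add (((dp t₀).neg.div w).mul (dm t)))).comp hρ
  · simp only [fun x => E1dot_eq t₀ hν hν' hμ (hρ0 x) ht]
    exact (((((m t₀).neg.div w).mul (dp t)).add (((p t₀).div w).mul (dm t)))).comp hρ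

end

/-! ### Scattering -/

theorem nuOf_spec {μ : ℝ} (hμ : 0 < μ) (hμ' : μ ≠ 1 / 4) :
    (μ : ℂ) = 1 / 4 - nuOf μ ^ 2 ∧ 0 ≤ (nuOf μ).re ∧ (nuOf μ).re < 1 / 2 ∧ nuOf μ ≠ 0 := by
  unfold nuOf
  split_ifs with h
  · have h1 : μ < 1 / 4 := lt_of_le_of_ne h hμ'
    have h2 : 0 < 1 - 4 * μ := by linarith
    have hs := Real.sqrt_pos.2 h2
    have hs1 : Real.sqrt (1 - 4 * μ) < 1 := by
      rw [Real.sqrt_lt' one_pos]; linarith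
    refine ⟨?_, ?_, ?_, ?_⟩
    · have : μ = 1 / 4 - (Real.sqrt (1 - 4 * μ) / 2) ^ 2 := by
        rw [div_pow, Real.sq_sqrt h2.le]; ring
      have h3 := congrArg Complex.ofReal this
      push_cast at h3 ⊢
      exact h3
    · rw [Complex.ofReal_re]; positivity
    · rw [Complex.ofReal_re]; linarith
    · exact_mod_cast (by positivity : Real.sqrt (1 - 4 * μ) / 2 ≠ 0)
  · have h2 : 0 < 4 * μ - 1 := by linarith [not_le.1 h]
    have hs := Real.sqrt_pos.2 h2
    refine ⟨?_, by simp, by simp, ?_⟩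
    · have : μ = 1 / 4 + (Real.sqrt (4 * μ - 1) / 2) ^ 2 := by
        rw [div_pow, Real.sq_sqrt h2.le]; ring
      rw [mul_pow, Complex.I_sq]
      rw [neg_one_mul, sub_neg_eq_add]
      have h3 := congrArg Complex.ofReal this
      push_cast at h3 ⊢
      exact h3
    · refine mul_ne_zero Complex.I_ne_zero ?_
      exact_mod_cast (by positivity : Real.sqrt (4 * μ - 1) / 2 ≠ 0)

/-- Pointwise scattering at frequency `r`, with bounds uniform in `r`. -/
theorem exists_mode_scattering {ν : ℂ} {μ : ℝ} (hμ0 : 0 < μ) (hμ : (μ : ℂ) = 1 / 4 - ν ^ 2)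
    (hν : 0 ≤ ν.re) (hν' : ν.re < 1 / 2) (hν0 : ν ≠ 0) :
    ∃ C > (0 : ℝ), ∀ r : ℝ, 0 ≤ r → ∀ z₀ z₁ : ℂ, ∃ k h : ℂ,
      Filter.Tendsto (fun n : ℕ =>
        (r : ℂ) * Complex.cos ((n : ℝ) * r) * (E0 ν r n 0 * z₀ + E1 ν r n 0 * z₁) -
        Complex.sin ((n : ℝ) * r) * (E0dot ν r n 0 * z₀ + E1dot ν r n 0 * z₁))
        Filter.atTop (nhds k) ∧
      Filter.Tendsto (fun n : ℕ =>
        (r : ℂ) * Complex.sin ((n : ℝ) * r) * (E0 ν r n 0 * z₀ + E1 ν r n 0 * z₁) +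
        Complex.cos ((n : ℝ) * r) * (E0dot ν r n 0 * z₀ + E1dot ν r n 0 * z₁))
        Filter.atTop (nhds h) ∧
      (r = 0 → k = 0) ∧
      ∀ t : ℝ, 0 ≤ t →
        ‖(r : ℂ) * Complex.cos (t * r) * (E0 ν r t 0 * z₀ + E1 ν r t 0 * z₁) -
          Complex.sin (t * r) * (E0dot ν r t 0 * z₀ + E1dot ν r t 0 * z₁) - k‖ ≤
            C * μ * (1 + t) ^ (-(1 / 2) + ν.re) * (‖z₀‖ + ‖z₁‖) ∧
        ‖(r : ℂ) * Complex.sin (t * r) * (E0 ν r t 0 * z₀ + E1 ν r t 0 * z₁) +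
          Complex.cos (t * r) * (E0dot ν r t 0 * z₀ + E1dot ν r t 0 * z₁) - h‖ ≤
            C * μ * (1 + t) ^ (-(1 / 2) + ν.re) * (‖z₀‖ + ‖z₁‖) := by
  obtain ⟨C, hC, hbd⟩ := exists_isModeSolution_norm_le hμ hν hν0
  have hσ : 1 / 2 + ν.re < 1 := by linarith
  have hσ' : 0 < 1 - (1 / 2 + ν.re) := by linarith
  have hlow : -(1 / 2) ≤ ν.re := by linarith
  refine ⟨C / (1 - (1 / 2 + ν.re)), by positivity, fun r hr z₀ z₁ => ?_⟩
  rcases hr.eq_or_lt with rfl | hr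
  · have e0 : ∀ t, E0 ν 0 t 0 = 0 := fun t => by simp [E0, ePlus_zero, eMinus_zero]
    have e1 : ∀ t, E1 ν 0 t 0 = 0 := fun t => by simp [E1, ePlus_zero, eMinus_zero]
    have e2 : ∀ t, E0dot ν 0 t 0 = 0 := fun t => by simp [E0dot, e0]
    have e3 : ∀ t, E1dot ν 0 t 0 = 0 := fun t => by simp [E1dot, e1]
    refine ⟨0, 0, by simp [e0, e1, e2, e3], by simp [e0, e1, e2, e3], fun _ => rfl,
      fun t ht => ?_⟩
    have : 0 ≤ C / (1 - (1 / 2 + ν.re)) * μ * (1 + t) ^ (-(1 / 2) + ν.re) * (‖z₀‖ + ‖z₁‖) := by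
      positivity
    simpa [e0, e1, e2, e3] using this
  · have hs := isModeSolution_propagator 0 hlow hν'.le hμ hr z₀ z₁
    obtain ⟨i0, i1⟩ := norm_propagator_initial_le hlow hν'.le hμ hr.le
      (by norm_num : (-1 : ℝ) < 0) z₀ z₁
    have hb : ∀ t, 0 ≤ t → ‖E0 ν r t 0 * z₀ + E1 ν r t 0 * z₁‖ ≤
        C * (‖z₀‖ + ‖z₁‖) * (1 + t) ^ (1 / 2 + ν.re) := fun t ht =>
      calc _ ≤ _ := hbd r hr _ _ hs t ht
        _ ≤ C * (1 + t) ^ (1 / 2 + ν.re) * (‖z₀‖ + ‖z₁‖) := by gcongr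
        _ = _ := by ring
    obtain ⟨k, hk, hk'⟩ := hs.exists_tendsto_cos_coeff hμ0.le (by positivity) hσ hb
    obtain ⟨h, hh, hh'⟩ := hs.exists_tendsto_sin_coeff hμ0.le (by positivity) hσ hb
    refine ⟨k, h, hk, hh, fun h0 => absurd h0 hr.ne', fun t ht => ?_⟩
    have e : μ * (C * (‖z₀‖ + ‖z₁‖)) / (1 - (1 / 2 + ν.re)) * (1 + t) ^ (1 / 2 + ν.re - 1) =
        C / (1 - (1 / 2 + ν.re)) * μ * (1 + t) ^ (-(1 / 2) + ν.re) * (‖z₀‖ + ‖z₁‖) := by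
      rw [show 1 / 2 + ν.re - 1 = -(1 / 2) + ν.re by ring]
      ring
    exact ⟨e ▸ hk' t ht, e ▸ hh' t ht⟩

theorem eLpNorm_le_ofReal_mul_add {α : Type*} [MeasurableSpace α] {m : Measure α}
    {F f g : α → ℂ} {c : ℝ} (hf : Measurable f) (hg : Measurable g)
    (hF : ∀ x, ‖F x‖ ≤ c * (‖f x‖ + ‖g x‖)) :
    eLpNorm F 2 m ≤ ENNReal.ofReal c * (eLpNorm f 2 m + eLpNorm g 2 m) := by
  have h1 : eLpNorm F 2 m ≤ ENNReal.ofReal c * eLpNorm (fun x => ‖f x‖ + ‖g x‖) 2 m :=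
    eLpNorm_le_mul_eLpNorm_of_ae_le_mul (Filter.Eventually.of_forall fun x => by
      rw [Real.norm_of_nonneg (by positivity : 0 ≤ ‖f x‖ + ‖g x‖)]; exact hF x) 2
  refine h1.trans ?_
  gcongr
  have h2 := eLpNorm_add_le (p := 2) (μ := m) hf.norm.aestronglyMeasurable
    hg.norm.aestronglyMeasurable (by norm_num)
  rw [eLpNorm_norm, eLpNorm_norm] at h2
  exact h2

theorem norm_cos_mul_add_sin_mul_le (x : ℝ) (a b : ℂ) :
    ‖Complex.cos x * a + Complex.sin x * b‖ ≤ ‖a‖ + ‖b‖ ∧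
      ‖Complex.cos x * b - Complex.sin x * a‖ ≤ ‖b‖ + ‖a‖ := by
  have hc : ‖Complex.cos x‖ ≤ 1 := by
    rw [← Complex.ofReal_cos, Complex.norm_real]; exact Real.abs_cos_le_one x
  have hs : ‖Complex.sin x‖ ≤ 1 := by
    rw [← Complex.ofReal_sin, Complex.norm_real]; exact Real.abs_sin_le_one x
  have hle : ∀ c z : ℂ, ‖c‖ ≤ 1 → ‖c * z‖ ≤ ‖z‖ := fun c z h => by
    rw [norm_mul]; exact mul_le_of_le_one_left (norm_nonneg z) h
  exact ⟨(norm_add_le _ _).trans (add_le_add (hle _ _ hc) (hle _ _ hs)),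
    (norm_sub_le _ _).trans (add_le_add (hle _ _ hc) (hle _ _ hs))⟩

/-- linear scattering with asymptotic order (Fourier formulation),
`μ > 0`, `μ ≠ 1/4`: the solution converges in `Ḣ¹ × L²` to a free wave with rate
`μ (1+t)^{−1/2+Re ν}`, with constant independent of `t` and of the data. -/
theorem stmt16 (d : ℕ) (hd : 1 ≤ d) (μ : ℝ) (hμ : 0 < μ) (hμ' : μ ≠ 1 / 4) :
    ∃ C > (0 : ℝ), ∀ g₀ g₁ : EuclideanSpace ℝ (Fin d) → ℂ,
      Measurable g₀ → Measurable g₁ →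
      eLpNorm g₀ 2 volume < ⊤ →
      eLpNorm (fun ξ => (‖ξ‖ : ℂ) * g₀ ξ) 2 volume < ⊤ →
      eLpNorm g₁ 2 volume < ⊤ →
      ∃ gp hp : EuclideanSpace ℝ (Fin d) → ℂ, Measurable gp ∧ Measurable hp ∧
        eLpNorm (fun ξ => (‖ξ‖ : ℂ) * gp ξ) 2 volume < ⊤ ∧
        eLpNorm hp 2 volume < ⊤ ∧
        ∀ t : ℝ, 0 ≤ t →
          eLpNorm (fun ξ =>
              (‖ξ‖ : ℂ) * (E0 (nuOf μ) ‖ξ‖ t 0 * g₀ ξ + E1 (nuOf μ) ‖ξ‖ t 0 * g₁ ξ) -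
                (‖ξ‖ : ℂ) * Complex.cos (t * ‖ξ‖) * gp ξ -
                Complex.sin (t * ‖ξ‖) * hp ξ) 2 volume +
          eLpNorm (fun ξ =>
              (E0dot (nuOf μ) ‖ξ‖ t 0 * g₀ ξ + E1dot (nuOf μ) ‖ξ‖ t 0 * g₁ ξ) +
                (‖ξ‖ : ℂ) * Complex.sin (t * ‖ξ‖) * gp ξ -
                Complex.cos (t * ‖ξ‖) * hp ξ) 2 volume ≤
            ENNReal.ofReal (C * μ * (1 + t) ^ (-(1 / 2) + (nuOf μ).re)) *
              (eLpNorm g₀ 2 volume + eLpNorm g₁ 2 volume) := by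
  obtain ⟨hν2, hν, hν', hν0⟩ := nuOf_spec hμ hμ'
  set ν := nuOf μ
  have hlow : -(1 / 2) ≤ ν.re := by linarith
  obtain ⟨C, hC, hsc⟩ := exists_mode_scattering hμ hν2 hν hν' hν0
  refine ⟨4 * C, by positivity, fun g₀ g₁ hg₀ hg₁ hn₀ hn₀' hn₁ => ?_⟩
  choose k h hk hh hk0 hbd using fun ξ : EuclideanSpace ℝ (Fin d) =>
    hsc ‖ξ‖ (norm_nonneg ξ) (g₀ ξ) (g₁ ξ)
  have hr : Measurable fun ξ : EuclideanSpace ℝ (Fin d) => (‖ξ‖ : ℂ) :=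
    Complex.measurable_ofReal.comp measurable_norm
  have hv : ∀ n : ℕ, Measurable fun ξ : EuclideanSpace ℝ (Fin d) =>
      E0 ν ‖ξ‖ n 0 * g₀ ξ + E1 ν ‖ξ‖ n 0 * g₁ ξ := fun n => by
    obtain ⟨m0, m1⟩ := measurable_propagator hlow hν'.le hν2 n 0
    exact ((m0.comp measurable_norm).mul hg₀).add ((m1.comp measurable_norm).mul hg₁)
  have hv' : ∀ n : ℕ, Measurable fun ξ : EuclideanSpace ℝ (Fin d) =>
      E0dot ν ‖ξ‖ n 0 * g₀ ξ + E1dot ν ‖ξ‖ n 0 * g₁ ξ := fun n => by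
    have hn : (-1 : ℝ) < n := by linarith [(n.cast_nonneg : (0 : ℝ) ≤ n)]
    obtain ⟨m0, m1⟩ := measurable_propagatorDot hlow hν'.le hν2 hn 0
      (measurable_norm (α := EuclideanSpace ℝ (Fin d))) norm_nonneg
    exact (m0.mul hg₀).add (m1.mul hg₁)
  have hcos : ∀ n : ℕ, Measurable fun ξ : EuclideanSpace ℝ (Fin d) =>
      Complex.cos ((n : ℝ) * ‖ξ‖) := fun n => Complex.measurable_cos.comp (hr.const_mul _)
  have hsin : ∀ n : ℕ, Measurable fun ξ : EuclideanSpace ℝ (Fin d) =>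
      Complex.sin ((n : ℝ) * ‖ξ‖) := fun n => Complex.measurable_sin.comp (hr.const_mul _)
  have mk : Measurable k := measurable_of_tendsto_metrizable
    (fun n => ((hr.mul (hcos n)).mul (hv n)).sub ((hsin n).mul (hv' n))) (tendsto_pi_nhds.2 hk)
  have mh : Measurable h := measurable_of_tendsto_metrizable
    (fun n => ((hr.mul (hsin n)).mul (hv n)).add ((hcos n).mul (hv' n))) (tendsto_pi_nhds.2 hh)
  have hkr : ∀ ξ, (‖ξ‖ : ℂ) * (k ξ / ‖ξ‖) = k ξ := fun ξ => by
    by_cases h0 : ‖ξ‖ = 0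
    · simp [hk0 ξ h0]
    · exact mul_div_cancel₀ _ (by exact_mod_cast h0)
  have bk : ∀ ξ, ‖k ξ‖ ≤ ‖(‖ξ‖ : ℂ) * g₀ ξ‖ + C * μ * (‖g₀ ξ‖ + ‖g₁ ξ‖) := fun ξ => by
    have h1 := (hbd ξ 0 le_rfl).1
    have h2 := (norm_propagator_initial_le hlow hν'.le hν2 (norm_nonneg ξ)
      (by norm_num : (-1 : ℝ) < 0) (g₀ ξ) (g₁ ξ)).1
    simp only [Complex.ofReal_zero, zero_mul, Complex.cos_zero, Complex.sin_zero, mul_one,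
      sub_zero, add_zero, Real.one_rpow] at h1
    refine (norm_le_norm_add_norm_sub _ _).trans (add_le_add ?_ h1)
    rw [norm_mul, norm_mul]
    gcongr
  have bh : ∀ ξ, ‖h ξ‖ ≤ ‖g₁ ξ‖ + C * μ * (‖g₀ ξ‖ + ‖g₁ ξ‖) := fun ξ => by
    have h1 := (hbd ξ 0 le_rfl).2
    have h2 := (norm_propagator_initial_le hlow hν'.le hν2 (norm_nonneg ξ)
      (by norm_num : (-1 : ℝ) < 0) (g₀ ξ) (g₁ ξ)).2
    simp only [Complex.ofReal_zero, zero_mul, Complex.cos_zero, Complex.sin_zero, mul_zero,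
      one_mul, zero_add, add_zero, mul_one, Real.one_rpow] at h1
    exact (norm_le_norm_add_norm_sub _ _).trans (add_le_add h2 h1)
  have l₀ : MemLp (fun ξ => ‖g₀ ξ‖) 2 volume :=
    MemLp.norm ⟨hg₀.aestronglyMeasurable, hn₀⟩
  have l₁ : MemLp (fun ξ => ‖g₁ ξ‖) 2 volume :=
    MemLp.norm ⟨hg₁.aestronglyMeasurable, hn₁⟩
  have lr : MemLp (fun ξ => ‖(‖ξ‖ : ℂ) * g₀ ξ‖) 2 volume :=
    MemLp.norm ⟨(hr.mul hg₀).aestronglyMeasurable, hn₀'⟩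
  have l₂ : MemLp (fun ξ => C * μ * (‖g₀ ξ‖ + ‖g₁ ξ‖)) 2 volume := (l₀.add l₁).const_mul (C * μ)
  refine ⟨fun ξ => k ξ / ‖ξ‖, h, mk.div hr, mh, ?_, ?_, fun t ht => ?_⟩
  · simp only [hkr]
    exact (eLpNorm_mono_real bk).trans_lt (lr.add l₂).2
  · exact (eLpNorm_mono_real bh).trans_lt (l₁.add l₂).2
  · set c := C * μ * (1 + t) ^ (-(1 / 2) + ν.re) with hc
    have hc0 : 0 ≤ c := by positivity
    have hcs : ∀ ξ : EuclideanSpace ℝ (Fin d),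
        Complex.cos (t * ‖ξ‖) ^ 2 + Complex.sin (t * ‖ξ‖) ^ 2 = 1 :=
      fun ξ => Complex.cos_sq_add_sin_sq _
    have hrk : ∀ ξ, (‖ξ‖ : ℂ) * Complex.cos (t * ‖ξ‖) * (k ξ / ‖ξ‖) =
        Complex.cos (t * ‖ξ‖) * k ξ := fun ξ => by
      linear_combination Complex.cos (t * ‖ξ‖) * hkr ξ
    have hrk' : ∀ ξ, (‖ξ‖ : ℂ) * Complex.sin (t * ‖ξ‖) * (k ξ / ‖ξ‖) =
        Complex.sin (t * ‖ξ‖) * k ξ := fun ξ => by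
      linear_combination Complex.sin (t * ‖ξ‖) * hkr ξ
    simp only [hrk, hrk']
    have b1 : eLpNorm (fun ξ =>
        (‖ξ‖ : ℂ) * (E0 ν ‖ξ‖ t 0 * g₀ ξ + E1 ν ‖ξ‖ t 0 * g₁ ξ) -
          Complex.cos (t * ‖ξ‖) * k ξ - Complex.sin (t * ‖ξ‖) * h ξ) 2 volume ≤
        ENNReal.ofReal (2 * c) * (eLpNorm g₀ 2 volume + eLpNorm g₁ 2 volume) := by
      refine eLpNorm_le_ofReal_mul_add hg₀ hg₁ fun ξ => ?_
      obtain ⟨b1, b2⟩ := hbd ξ t ht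
      have key := (norm_cos_mul_add_sin_mul_le (t * ‖ξ‖) _ _).1.trans (add_le_add b1 b2)
      rw [Complex.ofReal_mul] at key
      refine (le_of_eq ?_).trans (key.trans (le_of_eq (by ring)))
      congr 1
      linear_combination -(‖ξ‖ : ℂ) * (E0 ν ‖ξ‖ t 0 * g₀ ξ + E1 ν ‖ξ‖ t 0 * g₁ ξ) * hcs ξ
    have b2 : eLpNorm (fun ξ =>
        (E0dot ν ‖ξ‖ t 0 * g₀ ξ + E1dot ν ‖ξ‖ t 0 * g₁ ξ) +
          Complex.sin (t * ‖ξ‖) * k ξ - Complex.cos (t * ‖ξ‖) * h ξ) 2 volume ≤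
        ENNReal.ofReal (2 * c) * (eLpNorm g₀ 2 volume + eLpNorm g₁ 2 volume) := by
      refine eLpNorm_le_ofReal_mul_add hg₀ hg₁ fun ξ => ?_
      obtain ⟨b1, b2⟩ := hbd ξ t ht
      have key := (norm_cos_mul_add_sin_mul_le (t * ‖ξ‖) _ _).2.trans (add_le_add b2 b1)
      rw [Complex.ofReal_mul] at key
      refine (le_of_eq ?_).trans (key.trans (le_of_eq (by ring)))
      congr 1
      linear_combination -(E0dot ν ‖ξ‖ t 0 * g₀ ξ + E1dot ν ‖ξ‖ t 0 * g₁ ξ) * hcs ξ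
    calc _ ≤ _ := add_le_add b1 b2
      _ = ENNReal.ofReal (4 * C * μ * (1 + t) ^ (-(1 / 2) + ν.re)) *
          (eLpNorm g₀ 2 volume + eLpNorm g₁ 2 volume) := by
        rw [← add_mul, ← ENNReal.ofReal_add (by positivity) (by positivity), hc]
        congr 2
        ring

end
end

section
/- (Linear scattering with asymptotic order, Fourier formulation, μ = 1/4.) Let d ≥ 1 and μ = 1/4 (so ν = 0). Let g₀, g₁ : ℝ^d → ℂ be measurable with ‖g₀‖_{L²} + ‖|ξ|g₀‖_{L²} + ‖g₁‖_{L²} < ∞, and set v̂(t,ξ) := E_0(t,0,ξ) g₀(ξ) + E_1(t,0,ξ) g₁(ξ) and ∂_t v̂(t,ξ) := Ė_0(t,0,ξ) g₀(ξ) + Ė_1(t,0,ξ) g₁(ξ). Then there exist measurable g₊, h₊ : ℝ^d → ℂ with ‖|ξ|g₊‖_{L²} + ‖h₊‖_{L²} < ∞ and a constant C > 0 depending only on d (independent of t and of g₀, g₁) such that for all t ≥ 0: ‖ |ξ| v̂(t,·) − |ξ| cos(t|ξ|) g₊ − sin(t|ξ|) h₊ ‖_{L²} + ‖ ∂_t v̂(t,·)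 + |ξ| sin(t|ξ|) g₊ − cos(t|ξ|) h₊ ‖_{L²} ≤ C (1+t)^{−1/2} (1 + log(1+t)) (‖g₀‖_{L²} + ‖g₁‖_{L²}). -/
open MeasureTheory Real Set

noncomputable section

/-- `(w, p)` solves the first order system on `t > -1` equivalent, with `p = (1+t) w'`, to
Bessel's equation of order zero in the variable `(1+t) r`. -/
def IsBesselPair (r : ℝ) (w p : ℝ → ℂ) : Prop :=
  ∀ t : ℝ, -1 < t → HasDerivAt w (p t / ((1 + t : ℝ) : ℂ)) t ∧
    HasDerivAt p (-((r ^ 2 * (1 + t) : ℝ) : ℂ) * w t) t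

lemma IsBesselPair.lincomb {r : ℝ} {w p w' p' : ℝ → ℂ} (h : IsBesselPair r w p)
    (h' : IsBesselPair r w' p') (a b : ℂ) :
    IsBesselPair r (fun t => a * w t + b * w' t) (fun t => a * p t + b * p' t) := by
  intro t ht
  obtain ⟨h1, h2⟩ := h t ht
  obtain ⟨h3, h4⟩ := h' t ht
  refine ⟨((h1.const_mul a).add (h3.const_mul b)).congr_deriv (by ring),
    ((h2.const_mul a).add (h4.const_mul b)).congr_deriv (by ring)⟩

/-- Linear growth in `log (1+t)` as long as `(1+t) r ≤ 1`. -/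
lemma IsBesselPair.norm_le_of_mul_le_one {r A T : ℝ} {w p : ℝ → ℂ} (h : IsBesselPair r w p)
    (hw : ‖w 0‖ ≤ A) (hp : ‖p 0‖ ≤ A) (hr : 0 ≤ r) (hT : 0 ≤ T) (hrT : (1 + T) * r ≤ 1) :
    ‖w T‖ ≤ 2 * A * (1 + log (1 + T)) ∧ ‖p T‖ ≤ 2 * A * (1 + log (1 + T)) := by
  have hA : 0 ≤ A := (norm_nonneg _).trans hw
  have hcw : ContinuousOn w (Icc 0 T) := fun x hx =>
    (h x (by linarith [hx.1])).1.continuousAt.continuousWithinAt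
  have hcp : ContinuousOn p (Icc 0 T) := fun x hx =>
    (h x (by linarith [hx.1])).2.continuousAt.continuousWithinAt
  obtain ⟨s, hs, hmax⟩ := isCompact_Icc.exists_isMaxOn (nonempty_Icc.2 hT) hcw.norm
  have hM : ∀ x ∈ Icc 0 T, ‖w x‖ ≤ ‖w s‖ := fun x hx => hmax hx
  set M := ‖w s‖ with hMdef
  have hM0 : 0 ≤ M := norm_nonneg _
  have hsq : ∀ x ∈ Icc 0 T, r ^ 2 * (1 + x) ^ 2 ≤ 1 := by
    intro x hx
    have h1 : (1 + x) * r ≤ 1 := le_trans (by gcongr; exact hx.2) hrT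
    have h0 : 0 ≤ (1 + x) * r := mul_nonneg (by linarith [hx.1]) hr
    nlinarith
  have hP : ∀ x ∈ Icc 0 T, ‖p x‖ ≤ A + M * (r ^ 2 * (1 + x) ^ 2) / 2 := by
    have hB : ∀ x : ℝ, HasDerivAt (fun x : ℝ => A + M * (r ^ 2 * (1 + x) ^ 2) / 2)
        (M * (r ^ 2 * (1 + x))) x := by
      intro x
      have := ((((((hasDerivAt_id x).const_add 1).pow 2).const_mul (r ^ 2)).const_mul M).div_const
        2).const_add A
      exact this.congr_deriv (by simp; ring)
    intro x hx
    refine image_norm_le_of_norm_deriv_right_le_deriv_boundary hcp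
      (fun x hx => (h x (by linarith [hx.1])).2.hasDerivWithinAt) ?_ hB ?_ hx
    · have : 0 ≤ M * (r ^ 2 * (1 + 0) ^ 2) / 2 := by positivity
      linarith
    · intro x hx
      have h1 : 0 ≤ r ^ 2 * (1 + x) := mul_nonneg (sq_nonneg r) (by linarith [hx.1])
      rw [norm_mul, norm_neg, Complex.norm_real, norm_of_nonneg h1, mul_comm]
      gcongr
      exact hM x ⟨hx.1, hx.2.le⟩
  have hW : ∀ x ∈ Icc 0 T, ‖w x‖ ≤ A + A * log (1 + x) + M * (r ^ 2 * (1 + x) ^ 2) / 4 := by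
    have hB : ∀ x : ℝ, 0 ≤ x →
        HasDerivAt (fun x : ℝ => A + A * log (1 + x) + M * (r ^ 2 * (1 + x) ^ 2) / 4)
        (A / (1 + x) + M * (r ^ 2 * (1 + x)) / 2) x := by
      intro x hx
      have hx1 : (1 + x) ≠ 0 := by positivity
      have h2 := ((((((hasDerivAt_id x).const_add 1).pow 2).const_mul (r ^ 2)).const_mul
        M).div_const 4)
      have h3 := ((((hasDerivAt_id x).const_add 1).log hx1).const_mul A).const_add A
      exact (h3.add h2).congr_deriv (by simp; ring)
    intro x hx
    refine image_norm_le_of_norm_deriv_right_le_deriv_boundary' hcw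
      (fun x hx => (h x (by linarith [hx.1])).1.hasDerivWithinAt) ?_
      (fun x hx => (hB x hx.1).continuousAt.continuousWithinAt)
      (fun x hx => (hB x hx.1).hasDerivWithinAt) ?_ hx
    · have : 0 ≤ M * (r ^ 2 * (1 + 0) ^ 2) / 4 := by positivity
      simp only [add_zero, log_one, mul_zero] at *
      linarith
    · intro x hx
      have h1 : 0 < 1 + x := by linarith [hx.1]
      rw [norm_div, Complex.norm_real, norm_of_nonneg h1.le, div_le_iff₀ h1]
      refine (hP x ⟨hx.1, hx.2.le⟩).trans (le_of_eq ?_)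
      field_simp
  have hlog : log (1 + s) ≤ log (1 + T) :=
    Real.log_le_log (by linarith [hs.1]) (by linarith [hs.2])
  have h0 : 0 ≤ log (1 + T) := Real.log_nonneg (by linarith)
  have hMs : M ≤ 4 / 3 * (A * (1 + log (1 + T))) := by
    have h1 := hW s hs
    have h2 := mul_le_mul_of_nonneg_left (hsq s hs) hM0
    have h3 := mul_le_mul_of_nonneg_left hlog hA
    rw [← hMdef] at h1
    linarith
  have hT' : T ∈ Icc 0 T := ⟨hT, le_rfl⟩
  have hAL : A ≤ A * (1 + log (1 + T)) := by nlinarith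
  constructor
  · linarith [hM T hT']
  · have h2 := mul_le_mul_of_nonneg_left (hsq T hT') hM0
    linarith [hP T hT']

lemma IsBesselPair.energy_le {r a t : ℝ} {w p : ℝ → ℂ} (h : IsBesselPair r w p)
    (hr : 0 < r) (ha : 0 ≤ a) (hat : a ≤ t) :
    ‖w t‖ ^ 2 ≤ ‖p a‖ ^ 2 / (r ^ 2 * (1 + a) ^ 2) + ‖w a‖ ^ 2 := by
  have hd : ∀ x ∈ Ici a, HasDerivAt (fun x => ‖p x‖ ^ 2 / (r ^ 2 * (1 + x) ^ 2) + ‖w x‖ ^ 2)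
      (-(2 * ‖p x‖ ^ 2 / (r ^ 2 * (1 + x) ^ 3))) x := by
    intro x hx
    have hx0 : 0 < 1 + x := by linarith [mem_Ici.1 hx]
    obtain ⟨h1, h2⟩ := h x (by linarith)
    have h3 := (((hasDerivAt_id x).const_add 1).pow 2).const_mul (r ^ 2)
    refine ((h2.norm_sq.div h3 (ne_of_gt (show (0 : ℝ) < r ^ 2 * (1 + x) ^ 2 by positivity))).add h1.norm_sq).congr_deriv ?_
    have e1 : -((r ^ 2 * (1 + x) : ℝ) : ℂ) * w x = (-(r ^ 2 * (1 + x)) : ℝ) • w x := by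
      rw [Complex.real_smul]; push_cast; ring
    have e2 : p x / ((1 + x : ℝ) : ℂ) = (1 + x)⁻¹ • p x := by
      rw [Complex.real_smul]; push_cast; ring
    rw [e1, e2, inner_smul_right, inner_smul_right, real_inner_comm (p x) (w x)]
    simp only [id, Nat.cast_ofNat, Pi.pow_apply]
    field_simp
    ring
  have := antitoneOn_of_hasDerivWithinAt_nonpos (convex_Ici a)
    (fun x hx => (hd x hx).continuousAt.continuousWithinAt)
    (fun x hx => (hd x (interior_subset hx)).hasDerivWithinAt)
    (fun x hx => by
      have : 0 < 1 + x := by linarith [mem_Ici.1 (interior_subset hx)]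
      exact neg_nonpos.2 (by positivity))
  have h1 := this (mem_Ici.2 le_rfl) (mem_Ici.2 hat) hat
  have h2 : 0 ≤ ‖p t‖ ^ 2 / (r ^ 2 * (1 + t) ^ 2) := by positivity
  simp only at h1
  linarith

lemma IsBesselPair.norm_le {r A t : ℝ} {w p : ℝ → ℂ} (h : IsBesselPair r w p)
    (hw : ‖w 0‖ ≤ A) (hp : ‖p 0‖ ≤ A) (hr : 0 ≤ r) (ht : 0 ≤ t) :
    ‖w t‖ ≤ 4 * A * (1 + log (1 + t)) := by
  have hA : 0 ≤ A := (norm_nonneg _).trans hw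
  have h0 : 0 ≤ log (1 + t) := Real.log_nonneg (by linarith)
  have hAL : A ≤ A * (1 + log (1 + t)) := by nlinarith
  rcases le_total ((1 + t) * r) 1 with h1 | h1
  · linarith [(h.norm_le_of_mul_le_one hw hp hr ht h1).1]
  have hr0 : 0 < r := by
    rcases hr.eq_or_lt with h2 | h2
    · rw [← h2] at h1; norm_num at h1
    · exact h2
  rcases le_total 1 r with h2 | h2
  · have := h.energy_le hr0 le_rfl ht
    have h3 : ‖p 0‖ ^ 2 / (r ^ 2 * (1 + 0) ^ 2) ≤ A ^ 2 := by
      rw [div_le_iff₀ (by positivity)]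
      have : ‖p 0‖ ^ 2 ≤ A ^ 2 := by gcongr
      have hr1 : 1 ≤ r ^ 2 := one_le_pow₀ h2
      nlinarith [mul_le_mul_of_nonneg_left hr1 (sq_nonneg A)]
    have h4 : ‖w 0‖ ^ 2 ≤ A ^ 2 := by gcongr
    have : ‖w t‖ ≤ 2 * A := by
      refine abs_le_of_sq_le_sq' ?_ (by positivity) |>.2
      nlinarith
    linarith
  · set a := 1 / r - 1 with ha
    have hra : (1 + a) * r = 1 := by rw [ha]; field_simp; ring
    have ha0 : 0 ≤ a := by rw [ha, sub_nonneg, le_div_iff₀ hr0]; linarith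
    have hat : a ≤ t := by
      have : (1 + a) * r ≤ (1 + t) * r := by linarith
      linarith [le_of_mul_le_mul_right this hr0]
    obtain ⟨h3, h4⟩ := h.norm_le_of_mul_le_one hw hp hr ha0 hra.le
    have h5 := h.energy_le hr0 ha0 hat
    rw [show r ^ 2 * (1 + a) ^ 2 = 1 by rw [← mul_pow, mul_comm, hra, one_pow], div_one] at h5
    have hlog : log (1 + a) ≤ log (1 + t) :=
      Real.log_le_log (by linarith) (by linarith)
    have hB : 2 * A * (1 + log (1 + a)) ≤ 2 * A * (1 + log (1 + t)) := by gcongr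
    have h6 : ‖w a‖ ^ 2 ≤ (2 * A * (1 + log (1 + t))) ^ 2 :=
      pow_le_pow_left₀ (norm_nonneg _) (h3.trans hB) 2
    have h7 : ‖p a‖ ^ 2 ≤ (2 * A * (1 + log (1 + t))) ^ 2 :=
      pow_le_pow_left₀ (norm_nonneg _) (h4.trans hB) 2
    refine abs_le_of_sq_le_sq' ?_ (by positivity) |>.2
    nlinarith

/-- A function with increments bounded by a null function converges, with the corresponding rate. -/
lemma exists_limit_of_increment_le {U : ℝ → ℂ} {φ : ℝ → ℝ}
    (hU : ∀ a b, 0 ≤ a → a ≤ b → ‖U b - U a‖ ≤ φ a)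
    (hφ : Filter.Tendsto φ Filter.atTop (nhds 0)) :
    ∃ P, Filter.Tendsto U Filter.atTop (nhds P) ∧ ∀ t, 0 ≤ t → ‖U t - P‖ ≤ φ t := by
  have hc : CauchySeq U := by
    rw [Metric.cauchySeq_iff']
    intro ε hε
    obtain ⟨N, hN⟩ := ((hφ.eventually (gt_mem_nhds hε)).and
      (Filter.eventually_ge_atTop 0)).exists
    exact ⟨N, fun n hn => by
      rw [dist_eq_norm]; exact (hU N n hN.2 hn).trans_lt hN.1⟩
  obtain ⟨P, hP⟩ := cauchySeq_tendsto_of_complete hc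
  refine ⟨P, hP, fun t ht => ?_⟩
  rw [norm_sub_rev]
  exact le_of_tendsto (hP.sub_const (U t)).norm
    (Filter.eventually_atTop.2 ⟨t, fun b hb => hU t b ht hb⟩)

lemma tendsto_log_div_sqrt : Filter.Tendsto
    (fun t : ℝ => (3 + log (1 + t)) / √(1 + t)) Filter.atTop (nhds 0) := by
  have h1 : Filter.Tendsto (fun t : ℝ => 1 + t) Filter.atTop Filter.atTop :=
    Filter.tendsto_atTop_add_const_left _ _ Filter.tendsto_id
  have h2 : Filter.Tendsto (fun t : ℝ => log t / √t) Filter.atTop (nhds 0) := by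
    have := (isLittleO_log_rpow_atTop (r := 1 / 2) (by norm_num)).tendsto_div_nhds_zero
    simpa only [Real.sqrt_eq_rpow] using this
  have h3 : Filter.Tendsto (fun t : ℝ => 3 / √t) Filter.atTop (nhds 0) :=
    Real.tendsto_sqrt_atTop.const_div_atTop 3
  have := (h3.add h2).comp h1
  simpa [Function.comp_def, add_div] using this

lemma hasDerivAt_ofReal_sqrt_one_add {t : ℝ} (ht : -1 < t) :
    HasDerivAt (fun s : ℝ => ((√(1 + s) : ℝ) : ℂ)) (1 / (2 * (√(1 + t) : ℝ)) : ℂ) t := by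
  have := (((hasDerivAt_id t).const_add 1).sqrt (by simp; linarith)).ofReal_comp
  simpa using this

/-- The velocity of `t ↦ √(1+t) w(t)`. -/
def velocity (w p : ℝ → ℂ) (t : ℝ) : ℂ :=
  (w t / 2 + p t) / (√(1 + t) : ℝ)

lemma IsBesselPair.hasDerivAt_sqrt_mul {r t : ℝ} {w p : ℝ → ℂ} (h : IsBesselPair r w p)
    (ht : -1 < t) :
    HasDerivAt (fun s => ((√(1 + s) : ℝ) : ℂ) * w s) (velocity w p t) t := by
  refine ((hasDerivAt_ofReal_sqrt_one_add ht).mul (h t ht).1).congr_deriv ?_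
  have hs : 0 < √(1 + t) := Real.sqrt_pos.2 (by linarith)
  have e : ((1 + t : ℝ) : ℂ) = ((√(1 + t) : ℝ) : ℂ) ^ 2 := by
    rw [← Complex.ofReal_pow, Real.sq_sqrt (by linarith)]
  have hs' : ((√(1 + t) : ℝ) : ℂ) ≠ 0 := Complex.ofReal_ne_zero.2 hs.ne'
  rw [e, velocity]
  field_simp

lemma IsBesselPair.hasDerivAt_velocity {r t : ℝ} {w p : ℝ → ℂ} (h : IsBesselPair r w p)
    (ht : -1 < t) :
    HasDerivAt (velocity w p)
      (-((r : ℂ) ^ 2 + 1 / (4 * ((1 + t : ℝ) : ℂ) ^ 2)) * (((√(1 + t) : ℝ) : ℂ) * w t)) t := by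
  have hs : 0 < √(1 + t) := Real.sqrt_pos.2 (by linarith)
  have hs' : ((√(1 + t) : ℝ) : ℂ) ≠ 0 := Complex.ofReal_ne_zero.2 hs.ne'
  refine ((((h t ht).1.div_const 2).add (h t ht).2).div
    (hasDerivAt_ofReal_sqrt_one_add ht) hs').congr_deriv ?_
  have e : ((1 + t : ℝ) : ℂ) = ((√(1 + t) : ℝ) : ℂ) ^ 2 := by
    rw [← Complex.ofReal_pow, Real.sq_sqrt (by linarith)]
  rw [Complex.ofReal_mul, e]
  simp only [Pi.add_apply]
  field_simp
  push_cast
  ring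

/-- Pointwise scattering: the free profiles exist as limits of the rotated Cauchy data, at the
rate `(1+t)^{-1/2} (1 + log (1+t))`. -/
lemma IsBesselPair.exists_profile {r A : ℝ} {w p : ℝ → ℂ} (h : IsBesselPair r w p)
    (hw : ‖w 0‖ ≤ A) (hp : ‖p 0‖ ≤ A) (hr : 0 ≤ r) :
    ∃ P H : ℂ,
      Filter.Tendsto (fun t : ℝ => Complex.cos (t * r) * (r * ((√(1 + t) : ℝ) * w t)) -
        Complex.sin (t * r) * velocity w p t) Filter.atTop (nhds P) ∧
      Filter.Tendsto (fun t : ℝ => Complex.sin (t * r) * (r * ((√(1 + t) : ℝ) * w t)) +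
        Complex.cos (t * r) * velocity w p t) Filter.atTop (nhds H) ∧
      ∀ t : ℝ, 0 ≤ t →
        ‖r * ((√(1 + t) : ℝ) * w t) - Complex.cos (t * r) * P - Complex.sin (t * r) * H‖ ≤
          12 * (1 + log (1 + t)) / √(1 + t) * A ∧
        ‖velocity w p t + Complex.sin (t * r) * P - Complex.cos (t * r) * H‖ ≤
          12 * (1 + log (1 + t)) / √(1 + t) * A := by
  have hA : 0 ≤ A := (norm_nonneg _).trans hw
  set v : ℝ → ℂ := fun t => (√(1 + t) : ℝ) * w t with hv
  set u := velocity w p with hu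
  have hcos : ∀ t : ℝ, HasDerivAt (fun t : ℝ => Complex.cos (t * r))
      (-(Complex.sin (t * r) * r)) t := by
    intro t
    have := ((hasDerivAt_id (t : ℂ)).mul_const (r : ℂ)).ccos.comp_ofReal
    simpa using this
  have hsin : ∀ t : ℝ, HasDerivAt (fun t : ℝ => Complex.sin (t * r))
      (Complex.cos (t * r) * r) t := by
    intro t
    have := ((hasDerivAt_id (t : ℂ)).mul_const (r : ℂ)).csin.comp_ofReal
    simpa using this
  have ncos : ∀ t : ℝ, ‖Complex.cos (t * r)‖ ≤ 1 := fun t => by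
    rw [← Complex.ofReal_mul, ← Complex.ofReal_cos, Complex.norm_real]; exact Real.abs_cos_le_one _
  have nsin : ∀ t : ℝ, ‖Complex.sin (t * r)‖ ≤ 1 := fun t => by
    rw [← Complex.ofReal_mul, ← Complex.ofReal_sin, Complex.norm_real]; exact Real.abs_sin_le_one _
  have hdU : ∀ t : ℝ, 0 ≤ t → HasDerivAt (fun t : ℝ => Complex.cos (t * r) * (r * v t) -
      Complex.sin (t * r) * u t) (Complex.sin (t * r) * (1 / (4 * ((1 + t : ℝ) : ℂ) ^ 2) * v t)) t := by
    intro t ht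
    have ht' : -1 < t := by linarith
    refine (((hcos t).mul ((h.hasDerivAt_sqrt_mul ht').const_mul (r : ℂ))).sub
      ((hsin t).mul (h.hasDerivAt_velocity ht'))).congr_deriv ?_
    simp only [hv]
    ring
  have hdZ : ∀ t : ℝ, 0 ≤ t → HasDerivAt (fun t : ℝ => Complex.sin (t * r) * (r * v t) +
      Complex.cos (t * r) * u t)
      (-Complex.cos (t * r) * (1 / (4 * ((1 + t : ℝ) : ℂ) ^ 2) * v t)) t := by
    intro t ht
    have ht' : -1 < t := by linarith
    refine (((hsin t).mul ((h.hasDerivAt_sqrt_mul ht').const_mul (r : ℂ))).add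
      ((hcos t).mul (h.hasDerivAt_velocity ht'))).congr_deriv ?_
    simp only [hv]
    ring
  set φ : ℝ → ℝ := fun t => 2 * A * ((3 + log (1 + t)) / √(1 + t)) with hφ
  have hφ0 : ∀ t : ℝ, 0 ≤ t → 0 ≤ φ t := fun t ht => by
    have : 0 ≤ log (1 + t) := Real.log_nonneg (by linarith)
    positivity
  have hdφ : ∀ t : ℝ, 0 ≤ t → HasDerivAt (fun t => -φ t)
      (A * ((1 + log (1 + t)) / ((1 + t) * √(1 + t)))) t := by
    intro t ht
    have h1 : (0 : ℝ) < 1 + t := by linarith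
    have hs : 0 < √(1 + t) := Real.sqrt_pos.2 h1
    have hl := ((((hasDerivAt_id t).const_add 1).log h1.ne').const_add 3).div
      (((hasDerivAt_id t).const_add 1).sqrt h1.ne') hs.ne'
    refine (hl.const_mul (2 * A)).neg.congr_deriv ?_
    have e : (1 + t) = √(1 + t) ^ 2 := (Real.sq_sqrt h1.le).symm
    simp only [id]
    generalize log (1 + t) = L
    generalize √(1 + t) = s at *
    rw [e]
    field_simp
    ring
  have hsrc : ∀ t : ℝ, 0 ≤ t → ‖1 / (4 * ((1 + t : ℝ) : ℂ) ^ 2) * v t‖ ≤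
      A * ((1 + log (1 + t)) / ((1 + t) * √(1 + t))) := by
    intro t ht
    have h1 : (0 : ℝ) < 1 + t := by linarith
    have hs : 0 < √(1 + t) := Real.sqrt_pos.2 h1
    have e : (1 + t) = √(1 + t) ^ 2 := (Real.sq_sqrt h1.le).symm
    have := h.norm_le hw hp hr ht
    simp only [hv, norm_mul, norm_div, norm_one, norm_pow, Complex.norm_real, norm_of_nonneg h1.le,
      norm_of_nonneg hs.le, Complex.norm_ofNat]
    calc 1 / (4 * (1 + t) ^ 2) * (√(1 + t) * ‖w t‖)
        ≤ 1 / (4 * (1 + t) ^ 2) * (√(1 + t) * (4 * A * (1 + log (1 + t)))) := by gcongr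
      _ = A * ((1 + log (1 + t)) / ((1 + t) * √(1 + t))) := by
        generalize log (1 + t) = L
        generalize √(1 + t) = s at *
        rw [e]
        field_simp
  have key : ∀ (U U' : ℝ → ℂ), (∀ t, 0 ≤ t → HasDerivAt U (U' t) t) →
      (∀ t, 0 ≤ t → ‖U' t‖ ≤ A * ((1 + log (1 + t)) / ((1 + t) * √(1 + t)))) →
      ∃ P, Filter.Tendsto U Filter.atTop (nhds P) ∧ ∀ t, 0 ≤ t → ‖U t - P‖ ≤ φ t := by
    intro U U' hU hU'
    refine exists_limit_of_increment_le ?_ (by simpa using tendsto_log_div_sqrt.const_mul (2 * A))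
    intro a b ha hab
    have hd : ∀ x ∈ Icc a b, HasDerivAt (fun x => φ a - φ x)
        (A * ((1 + log (1 + x)) / ((1 + x) * √(1 + x)))) x := fun x hx => by
      simpa [sub_eq_add_neg] using (hdφ x (ha.trans hx.1)).const_add (φ a)
    have := image_norm_le_of_norm_deriv_right_le_deriv_boundary' (f := fun x => U x - U a)
      (fun x hx => ((hU x (ha.trans hx.1)).sub_const _).continuousAt.continuousWithinAt)
      (fun x hx => ((hU x (ha.trans hx.1)).sub_const _).hasDerivWithinAt) (by simp)
      (fun x hx => (hd x hx).continuousAt.continuousWithinAt)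
      (fun x hx => (hd x (Ico_subset_Icc_self hx)).hasDerivWithinAt)
      (fun x hx => hU' x (ha.trans hx.1)) (right_mem_Icc.2 hab)
    linarith [hφ0 b (ha.trans hab)]
  obtain ⟨P, hP, hPe⟩ := key _ _ hdU fun t ht => by
    rw [norm_mul]
    exact (mul_le_of_le_one_left (norm_nonneg _) (nsin t)).trans (hsrc t ht)
  obtain ⟨H, hH, hHe⟩ := key _ _ hdZ fun t ht => by
    rw [norm_mul, norm_neg]
    exact (mul_le_of_le_one_left (norm_nonneg _) (ncos t)).trans (hsrc t ht)
  refine ⟨P, H, hP, hH, fun t ht => ?_⟩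
  have hφle : φ t + φ t ≤ 12 * (1 + log (1 + t)) / √(1 + t) * A := by
    have : 0 ≤ log (1 + t) := Real.log_nonneg (by linarith)
    have h2 : (3 + log (1 + t)) / √(1 + t) ≤ 3 * (1 + log (1 + t)) / √(1 + t) := by
      gcongr; linarith
    calc φ t + φ t = 4 * A * ((3 + log (1 + t)) / √(1 + t)) := by simp only [hφ]; ring
      _ ≤ 4 * A * (3 * (1 + log (1 + t)) / √(1 + t)) := by gcongr
      _ = _ := by ring
  have hcs := Complex.sin_sq_add_cos_sq (t * r)
  have comb : ∀ a b X Y : ℂ, ‖a‖ ≤ 1 → ‖b‖ ≤ 1 → ‖X‖ ≤ φ t → ‖Y‖ ≤ φ t →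
      ‖a * X + b * Y‖ ≤ φ t + φ t := by
    intro a b X Y ha hb hX hY
    refine (norm_add_le _ _).trans (add_le_add ?_ ?_) <;> rw [norm_mul]
    · exact (mul_le_of_le_one_left (norm_nonneg _) ha).trans hX
    · exact (mul_le_of_le_one_left (norm_nonneg _) hb).trans hY
  constructor
  · refine le_trans (le_of_eq ?_) ((comb _ _ _ _ (ncos t) (nsin t) (hPe t ht) (hHe t ht)).trans hφle)
    congr 1
    linear_combination (-(r * v t)) * hcs
  · refine le_trans (le_of_eq ?_) ((comb (-Complex.sin (t * r)) _ _ _ (by rw [norm_neg]; exact nsin t)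
      (ncos t) (hPe t ht) (hHe t ht)).trans hφle)
    congr 1
    linear_combination (-(u t)) * hcs
lemma summable_of_norm_le_div_factorial {a : ℕ → ℂ} {C : ℝ}
    (ha : ∀ k, ‖a k‖ ≤ C / k.factorial) (z : ℂ) : Summable fun k => a k * z ^ k := by
  refine Summable.of_norm_bounded ((Real.summable_pow_div_factorial ‖z‖).mul_left C) fun k => ?_
  rw [norm_mul, norm_pow]
  calc ‖a k‖ * ‖z‖ ^ k ≤ C / k.factorial * ‖z‖ ^ k := by gcongr; exact ha k
    _ = _ := by ring

/-- Termwise differentiation of a power series with coefficients `O(1/k!)`. -/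
lemma hasDerivAt_tsum_of_norm_le_div_factorial {a : ℕ → ℂ} {C : ℝ}
    (ha : ∀ k, ‖a k‖ ≤ C / k.factorial) (z : ℂ) :
    HasDerivAt (fun z => ∑' k, a k * z ^ k) (∑' k, ((k + 1 : ℕ) : ℂ) * a (k + 1) * z ^ k) z := by
  have hC : 0 ≤ C := by simpa using (norm_nonneg _).trans (ha 0)
  set R := ‖z‖ + 1 with hR
  have hR0 : 0 ≤ R := by positivity
  have hsum : Summable fun k : ℕ => ‖a k‖ * (k * R ^ (k - 1)) := by
    rw [← summable_nat_add_iff 1]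
    refine Summable.of_nonneg_of_le (fun k => by positivity) (fun k => ?_)
      ((Real.summable_pow_div_factorial R).mul_left C)
    calc ‖a (k + 1)‖ * (((k + 1 : ℕ) : ℝ) * R ^ (k + 1 - 1))
        ≤ C / (k + 1).factorial * (((k + 1 : ℕ) : ℝ) * R ^ (k + 1 - 1)) := by gcongr; exact ha _
      _ = _ := by
        rw [Nat.factorial_succ]; rw [Nat.add_sub_cancel]; push_cast; field_simp
  have hder : ∀ (k : ℕ) (y : ℂ), y ∈ Metric.ball (0 : ℂ) R →
      HasDerivAt (fun y => a k * y ^ k) (a k * (k * y ^ (k - 1))) y := fun k y _ =>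
    (hasDerivAt_pow k y).const_mul (a k)
  have hbd : ∀ (k : ℕ) (y : ℂ), y ∈ Metric.ball (0 : ℂ) R →
      ‖a k * (k * y ^ (k - 1))‖ ≤ ‖a k‖ * (k * R ^ (k - 1)) := by
    intro k y hy
    rw [mem_ball_zero_iff] at hy
    rw [norm_mul, norm_mul, norm_pow, Complex.norm_natCast]
    gcongr
  have hz : z ∈ Metric.ball (0 : ℂ) R := by rw [mem_ball_zero_iff]; linarith
  have h := hasDerivAt_tsum_of_isPreconnected hsum Metric.isOpen_ball
    (convex_ball (0 : ℂ) R).isPreconnected hder hbd hz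
    (summable_of_norm_le_div_factorial ha z) hz
  refine h.congr_deriv ?_
  rw [(Summable.of_norm_bounded hsum (fun k => hbd k z hz)).tsum_eq_zero_add]
  simp only [Nat.cast_zero, zero_mul, mul_zero, zero_add, Nat.add_sub_cancel]
  exact tsum_congr fun k => by ring

/-- The Euler derivative `z f'(z)` of a power series `f` with coefficients `O(1/k!)`. -/
lemma mul_tsum_shift {a : ℕ → ℂ} {C : ℝ}
    (ha : ∀ k : ℕ, ‖(k : ℂ) * a k‖ ≤ C / k.factorial) (z : ℂ) :
    z * ∑' k, ((k + 1 : ℕ) : ℂ) * a (k + 1) * z ^ k = ∑' k : ℕ, ((k : ℂ) * a k) * z ^ k := by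
  rw [(summable_of_norm_le_div_factorial ha z).tsum_eq_zero_add, ← tsum_mul_left]
  simp only [Nat.cast_zero, zero_mul, zero_add]
  exact tsum_congr fun k => by ring

/-- Coefficients of `J₀` as a power series in `(τ/2)²`. -/
def jCoeff (k : ℕ) : ℂ := (-1) ^ k / (k.factorial : ℂ) ^ 2

/-- Coefficients of the non-logarithmic part of `Y₀` as a power series in `(τ/2)²`. -/
def hCoeff (k : ℕ) : ℂ := (-1) ^ (k + 1) * ((harmonic k : ℚ) : ℂ) / (k.factorial : ℂ) ^ 2

lemma self_le_factorial_real (k : ℕ) : (k : ℝ) ≤ k.factorial := by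
  exact_mod_cast Nat.self_le_factorial k

lemma norm_jCoeff (k : ℕ) : ‖jCoeff k‖ = 1 / (k.factorial : ℝ) ^ 2 := by
  simp [jCoeff]

lemma norm_jCoeff_le (k : ℕ) : ‖jCoeff k‖ ≤ 1 / k.factorial := by
  rw [norm_jCoeff]
  have h : (1 : ℝ) ≤ k.factorial := by exact_mod_cast k.factorial_pos
  gcongr
  nlinarith

lemma norm_mul_jCoeff_le (k : ℕ) : ‖(k : ℂ) * jCoeff k‖ ≤ 1 / k.factorial := by
  rw [norm_mul, norm_jCoeff, Complex.norm_natCast]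
  have h : (0 : ℝ) < k.factorial := by exact_mod_cast k.factorial_pos
  rw [mul_one_div, div_le_div_iff₀ (by positivity) h]
  nlinarith [self_le_factorial_real k]

lemma harmonic_nonneg_le (k : ℕ) : 0 ≤ harmonic k ∧ harmonic k ≤ k := by
  induction k with
  | zero => simp
  | succ k ih =>
    rw [harmonic_succ]
    have h1 : ((k + 1 : ℕ) : ℚ)⁻¹ ≤ 1 := 
      inv_le_one_of_one_le₀ (by push_cast; linarith [k.cast_nonneg (α := ℚ)])
    have h2 : (0 : ℚ) ≤ ((k + 1 : ℕ) : ℚ)⁻¹ := by positivity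
    push_cast at *
    exact ⟨by linarith, by linarith⟩

lemma norm_hCoeff_le_aux (k : ℕ) : ‖hCoeff k‖ ≤ k / (k.factorial : ℝ) ^ 2 := by
  have h1 : ‖((harmonic k : ℚ) : ℂ)‖ ≤ k := by
    rw [Complex.norm_ratCast, abs_of_nonneg (by exact_mod_cast (harmonic_nonneg_le k).1)]
    exact_mod_cast (harmonic_nonneg_le k).2
  simp only [hCoeff, norm_div, norm_mul, norm_pow, norm_neg, norm_one, one_pow, one_mul,
    Complex.norm_natCast]
  gcongr

lemma norm_hCoeff_le (k : ℕ) : ‖hCoeff k‖ ≤ 1 / k.factorial := by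
  have h : (0 : ℝ) < k.factorial := by exact_mod_cast k.factorial_pos
  refine (norm_hCoeff_le_aux k).trans ?_
  rw [div_le_div_iff₀ (by positivity) h]
  nlinarith [self_le_factorial_real k]

lemma sq_le_two_mul_factorial (k : ℕ) : k * k ≤ 2 * k.factorial := by
  rcases k with _ | _ | _ | k
  · simp
  · simp
  · simp [Nat.factorial]
  · have h : k + 2 ≤ (k + 2).factorial := Nat.self_le_factorial _
    rw [Nat.factorial_succ (k + 2)]
    nlinarith

lemma norm_mul_hCoeff_le (k : ℕ) : ‖(k : ℂ) * hCoeff k‖ ≤ 2 / k.factorial := by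
  have h : (0 : ℝ) < k.factorial := by exact_mod_cast k.factorial_pos
  rw [norm_mul, Complex.norm_natCast]
  calc (k : ℝ) * ‖hCoeff k‖ ≤ k * (k / (k.factorial : ℝ) ^ 2) := by
        gcongr; exact norm_hCoeff_le_aux k
    _ ≤ _ := by
      rw [← mul_div_assoc, div_le_div_iff₀ (by positivity) h]
      have : (k : ℝ) * k ≤ 2 * k.factorial := by exact_mod_cast sq_le_two_mul_factorial k
      nlinarith

/-- `J₀(τ) = jSeries ((τ/2)²)`. -/
def jSeries (z : ℂ) : ℂ := ∑' k, jCoeff k * z ^ k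

/-- `z · jSeries' z`. -/
def jEuler (z : ℂ) : ℂ := ∑' k : ℕ, ((k : ℂ) * jCoeff k) * z ^ k

/-- The derivative of `jSeries`. -/
def jDeriv (z : ℂ) : ℂ := ∑' k, ((k + 1 : ℕ) : ℂ) * jCoeff (k + 1) * z ^ k

/-- The non-logarithmic part of `Y₀`, up to the factor `2/π`. -/
def hSeries (z : ℂ) : ℂ := ∑' k, hCoeff k * z ^ k

/-- `z · hSeries' z`. -/
def hEuler (z : ℂ) : ℂ := ∑' k : ℕ, ((k : ℂ) * hCoeff k) * z ^ k

lemma hasDerivAt_jSeries (z : ℂ) : HasDerivAt jSeries (jDeriv z) z :=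
  hasDerivAt_tsum_of_norm_le_div_factorial norm_jCoeff_le z

lemma mul_jDeriv (z : ℂ) : z * jDeriv z = jEuler z := mul_tsum_shift norm_mul_jCoeff_le z

lemma hasDerivAt_jEuler (z : ℂ) : HasDerivAt jEuler (-jSeries z) z := by
  refine (hasDerivAt_tsum_of_norm_le_div_factorial norm_mul_jCoeff_le z).congr_deriv ?_
  rw [jSeries, ← tsum_neg]
  refine tsum_congr fun k => ?_
  have h : (k.factorial : ℂ) ≠ 0 := by exact_mod_cast k.factorial_ne_zero
  have h' : (k : ℂ) + 1 ≠ 0 := by exact_mod_cast k.succ_ne_zero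
  simp only [jCoeff, Nat.factorial_succ, pow_succ (-1 : ℂ) k]
  push_cast
  field_simp

lemma hasDerivAt_hSeries {z : ℂ} (hz : z ≠ 0) : HasDerivAt hSeries (hEuler z / z) z := by
  refine (hasDerivAt_tsum_of_norm_le_div_factorial norm_hCoeff_le z).congr_deriv ?_
  rw [eq_div_iff hz, mul_comm, mul_tsum_shift norm_mul_hCoeff_le z, hEuler]

lemma summable_jDeriv (z : ℂ) :
    Summable fun k : ℕ => ((k + 1 : ℕ) : ℂ) * jCoeff (k + 1) * z ^ k := by
  refine summable_of_norm_le_div_factorial (C := 1) (fun k => ?_) z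
  refine (norm_mul_jCoeff_le (k + 1)).trans ?_
  have h : (0 : ℝ) < k.factorial := by exact_mod_cast k.factorial_pos
  gcongr
  exact Nat.le_succ k

lemma hasDerivAt_hEuler (z : ℂ) : HasDerivAt hEuler (-hSeries z - jDeriv z) z := by
  refine (hasDerivAt_tsum_of_norm_le_div_factorial norm_mul_hCoeff_le z).congr_deriv ?_
  rw [hSeries, jDeriv, ← tsum_neg, ← Summable.tsum_sub
    (summable_of_norm_le_div_factorial norm_hCoeff_le z).neg (summable_jDeriv z)]
  refine tsum_congr fun k => ?_
  have h : (k.factorial : ℂ) ≠ 0 := by exact_mod_cast k.factorial_ne_zero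
  have h' : (k : ℂ) + 1 ≠ 0 := by exact_mod_cast k.succ_ne_zero
  simp only [jCoeff, hCoeff, Nat.factorial_succ, pow_succ (-1 : ℂ), harmonic_succ]
  push_cast
  field_simp
  ring

/-- `Y₀(τ) = (2/π) yFun ((τ/2)²)` for `τ > 0`. -/
def yFun (z : ℂ) : ℂ :=
  (Complex.log z / 2 + (Real.eulerMascheroniConstant : ℂ)) * jSeries z + hSeries z

/-- `z · yFun' z`. -/
def yEuler (z : ℂ) : ℂ :=
  jSeries z / 2 + (Complex.log z / 2 + (Real.eulerMascheroniConstant : ℂ)) * jEuler z + hEuler z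

lemma hasDerivAt_yFun {z : ℂ} (hz : z ∈ Complex.slitPlane) :
    HasDerivAt yFun (yEuler z / z) z := by
  have h0 := Complex.slitPlane_ne_zero hz
  refine (((((Complex.hasDerivAt_log hz).div_const 2).add_const _).mul
    (hasDerivAt_jSeries z)).add (hasDerivAt_hSeries h0)).congr_deriv ?_
  rw [yEuler, ← mul_jDeriv]
  field_simp

lemma hasDerivAt_yEuler {z : ℂ} (hz : z ∈ Complex.slitPlane) :
    HasDerivAt yEuler (-yFun z) z := by
  have h0 := Complex.slitPlane_ne_zero hz
  refine ((((hasDerivAt_jSeries z).div_const 2).add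
    ((((Complex.hasDerivAt_log hz).div_const 2).add_const _).mul
    (hasDerivAt_jEuler z))).add (hasDerivAt_hEuler z)).congr_deriv ?_
  rw [yFun, ← mul_jDeriv]
  field_simp
  ring
lemma besselJ_zero_eq (τ : ℝ) : besselJ 0 τ = jSeries ((((τ / 2) ^ 2 : ℝ)) : ℂ) := by
  rw [besselJ, jSeries]
  refine tsum_congr fun k => ?_
  rw [zero_add, zero_add, Complex.Gamma_nat_eq_factorial, jCoeff,
    show (2 : ℂ) * (k : ℂ) = ((2 * k : ℕ) : ℂ) by push_cast; rfl, Complex.cpow_natCast, pow_mul]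
  push_cast
  ring

lemma besselY0_eq {τ : ℝ} (hτ : 0 < τ) :
    besselY0 τ = 2 / (π : ℂ) * yFun ((((τ / 2) ^ 2 : ℝ)) : ℂ) := by
  have hlog : Complex.log (((τ / 2) ^ 2 : ℝ) : ℂ) / 2 = Complex.log ((τ : ℂ) / 2) := by
    rw [← Complex.ofReal_log (by positivity), Real.log_pow,
      show (τ : ℂ) / 2 = ((τ / 2 : ℝ) : ℂ) by push_cast; rfl, ← Complex.ofReal_log (by positivity)]
    push_cast
    ring
  have hser : hSeries ((((τ / 2) ^ 2 : ℝ)) : ℂ) = ∑' k : ℕ,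
      ((-1 : ℂ) ^ ((k + 1) + 1) * ((harmonic (k + 1) : ℚ) : ℂ) /
          ((Nat.factorial (k + 1) : ℂ)) ^ 2) * ((τ : ℂ) / 2) ^ (2 * (k + 1)) := by
    rw [hSeries, (summable_of_norm_le_div_factorial norm_hCoeff_le _).tsum_eq_zero_add]
    simp only [hCoeff, harmonic_zero, Rat.cast_zero, mul_zero, zero_div, zero_mul, zero_add]
    refine tsum_congr fun k => ?_
    rw [pow_mul]
    push_cast
    rfl
  rw [besselY0, yFun, hlog, hser, besselJ_zero_eq]
  ring

/-- Solutions of Bessel's equation in the variable `z = (τ/2)²` give Bessel pairs. -/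
lemma isBesselPair_comp {f f₁ : ℂ → ℂ}
    (hf : ∀ z ∈ Complex.slitPlane, HasDerivAt f (f₁ z / z) z)
    (hf₁ : ∀ z ∈ Complex.slitPlane, HasDerivAt f₁ (-f z) z) {r : ℝ} (hr : 0 < r) :
    IsBesselPair r (fun t => f ((((1 + t) * r / 2) ^ 2 : ℝ) : ℂ))
      (fun t => 2 * f₁ ((((1 + t) * r / 2) ^ 2 : ℝ) : ℂ)) := by
  intro t ht
  have h1 : 0 < 1 + t := by linarith
  have hz : 0 < ((1 + t) * r / 2) ^ 2 := by positivity
  have hz' : ((((1 + t) * r / 2) ^ 2 : ℝ) : ℂ) ∈ Complex.slitPlane :=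
    Complex.ofReal_mem_slitPlane.2 hz
  have hd : HasDerivAt (fun t : ℝ => ((((1 + t) * r / 2) ^ 2 : ℝ) : ℂ))
      (((1 + t) * r ^ 2 / 2 : ℝ) : ℂ) t := by
    refine HasDerivAt.ofReal_comp ?_
    refine ((((((hasDerivAt_id t).const_add 1).mul_const r).div_const 2).pow 2)).congr_deriv ?_
    simp only [id]
    push_cast
    ring
  have hr' : (r : ℂ) ≠ 0 := Complex.ofReal_ne_zero.2 hr.ne'
  have h1' : (1 + t : ℂ) ≠ 0 := by exact_mod_cast h1.ne'
  constructor
  · refine ((hf _ hz').comp t hd).congr_deriv ?_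
    beta_reduce
    generalize f₁ _ = F
    push_cast
    field_simp
  · refine (((hf₁ _ hz').comp t hd).const_mul 2).congr_deriv ?_
    beta_reduce
    generalize f _ = F
    push_cast
    ring

lemma isBesselPair_zero (r : ℝ) : IsBesselPair r (fun _ => 0) (fun _ => 0) := fun t _ =>
  ⟨(hasDerivAt_const t (0 : ℂ)).congr_deriv (by simp),
    (hasDerivAt_const t (0 : ℂ)).congr_deriv (by simp)⟩

lemma ofReal_sqrt_mul {r t : ℝ} (ht : -1 < t) :
    ((√((1 + t) * r) : ℝ) : ℂ) = (√(1 + t) : ℝ) * (√r : ℝ) := by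
  rw [Real.sqrt_mul (by linarith), Complex.ofReal_mul]

lemma exists_isBesselPair_ePlus {r : ℝ} (hr : 0 ≤ r) : ∃ w p, IsBesselPair r w p ∧
    ∀ t : ℝ, -1 < t → ePlus 0 r t = (√(1 + t) : ℝ) * w t := by
  rcases hr.eq_or_lt with rfl | hr
  · exact ⟨_, _, isBesselPair_zero 0, fun t _ => by simp [ePlus]⟩
  have h := isBesselPair_comp (f := jSeries) (f₁ := jEuler)
    (fun z hz => (hasDerivAt_jSeries z).congr_deriv (by
      rw [← mul_jDeriv, mul_div_cancel_left₀ _ (Complex.slitPlane_ne_zero hz)]))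
    (fun z _ => hasDerivAt_jEuler z) hr
  refine ⟨_, _, h.lincomb h (√r : ℝ) 0, fun t ht => ?_⟩
  rw [ePlus, ofReal_sqrt_mul ht, besselJ_zero_eq]
  ring

lemma exists_isBesselPair_eMinusZ {r : ℝ} (hr : 0 ≤ r) : ∃ w p, IsBesselPair r w p ∧
    ∀ t : ℝ, -1 < t → eMinusZ r t = (√(1 + t) : ℝ) * w t := by
  rcases hr.eq_or_lt with rfl | hr
  · exact ⟨_, _, isBesselPair_zero 0, fun t _ => by simp [eMinusZ]⟩
  have h := isBesselPair_comp (f := yFun) (f₁ := yEuler)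
    (fun z hz => hasDerivAt_yFun hz) (fun z hz => hasDerivAt_yEuler hz) hr
  refine ⟨_, _, h.lincomb h ((√r : ℝ) * (2 / (π : ℂ))) 0, fun t ht => ?_⟩
  rw [eMinusZ, ofReal_sqrt_mul ht, besselY0_eq (mul_pos (by linarith) hr)]
  ring

lemma IsBesselPair.hasDerivAt_of_eq {r t : ℝ} {w p f : ℝ → ℂ} (h : IsBesselPair r w p)
    (hf : ∀ t : ℝ, -1 < t → f t = (√(1 + t) : ℝ) * w t) (ht : -1 < t) :
    HasDerivAt f (velocity w p t) t := by
  refine (h.hasDerivAt_sqrt_mul ht).congr_of_eventuallyEq ?_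
  filter_upwards [lt_mem_nhds ht] with s hs using hf s hs

/-- The propagators `E₀, E₁` at `t₀ = 0` come from Bessel pairs with bounded Cauchy data. -/
lemma exists_isBesselPair_propagators {r : ℝ} (hr : 0 ≤ r) : ∃ w₀ p₀ w₁ p₁ : ℝ → ℂ,
    IsBesselPair r w₀ p₀ ∧ IsBesselPair r w₁ p₁ ∧
    (∀ t : ℝ, -1 < t → E0Z r t 0 = (√(1 + t) : ℝ) * w₀ t) ∧
    (∀ t : ℝ, -1 < t → E1Z r t 0 = (√(1 + t) : ℝ) * w₁ t) ∧
    ‖w₀ 0‖ ≤ 1 ∧ ‖p₀ 0‖ ≤ 1 ∧ w₁ 0 = 0 ∧ ‖p₁ 0‖ ≤ 1 := by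
  obtain ⟨w, p, h, he⟩ := exists_isBesselPair_ePlus hr
  obtain ⟨w', p', h', he'⟩ := exists_isBesselPair_eMinusZ hr
  have d0 : ePlusDot 0 r 0 = w 0 / 2 + p 0 := by
    rw [ePlusDot, (h.hasDerivAt_of_eq he (by norm_num)).deriv]; simp [velocity]
  have d0' : eMinusZDot r 0 = w' 0 / 2 + p' 0 := by
    rw [eMinusZDot, (h'.hasDerivAt_of_eq he' (by norm_num)).deriv]; simp [velocity]
  have v0 : ePlus 0 r 0 = w 0 := by rw [he 0 (by norm_num)]; simp
  have v0' : eMinusZ r 0 = w' 0 := by rw [he' 0 (by norm_num)]; simp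
  set W := ePlus 0 r 0 * eMinusZDot r 0 - ePlusDot 0 r 0 * eMinusZ r 0 with hW
  have hW' : W = w 0 * p' 0 - p 0 * w' 0 := by rw [hW, d0, d0', v0, v0']; ring
  have hWW : ‖W / W‖ ≤ 1 := by rw [norm_div]; exact div_self_le_one _
  refine ⟨_, _, _, _, h.lincomb h' (eMinusZDot r 0 / W) (-(ePlusDot 0 r 0) / W),
    h.lincomb h' (-(eMinusZ r 0) / W) (ePlus 0 r 0 / W), fun t ht => ?_, fun t ht => ?_,
    ?_, ?_, ?_, ?_⟩
  · rw [E0Z, he t ht, he' t ht, ← hW]; ring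
  · rw [E1Z, he t ht, he' t ht, ← hW]; ring
  · refine le_trans (le_of_eq ?_) hWW
    congr 1
    rw [d0, d0']; nth_rewrite 3 [hW']; ring
  · have : eMinusZDot r 0 / W * p 0 + -(ePlusDot 0 r 0) / W * p' 0 = -(1 / 2) * (W / W) := by
      rw [d0, d0']; nth_rewrite 3 [hW']; ring
    rw [this, norm_mul, show ‖-(1 / 2 : ℂ)‖ = 1 / 2 by norm_num]
    linarith
  · rw [v0, v0']; ring
  · refine le_trans (le_of_eq ?_) hWW
    congr 1
    rw [v0, v0']; nth_rewrite 3 [hW']; ring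

/-- Pointwise (fixed frequency) scattering for the Klein–Gordon propagator with `μ = 1/4`. -/
lemma exists_profile_propagator {r : ℝ} (hr : 0 ≤ r) (c₀ c₁ : ℂ) : ∃ P H : ℂ,
    Filter.Tendsto (fun t : ℝ => Complex.cos (t * r) * (r * (E0Z r t 0 * c₀ + E1Z r t 0 * c₁)) -
      Complex.sin (t * r) * (E0Zdot r t 0 * c₀ + E1Zdot r t 0 * c₁)) Filter.atTop (nhds P) ∧
    Filter.Tendsto (fun t : ℝ => Complex.sin (t * r) * (r * (E0Z r t 0 * c₀ + E1Z r t 0 * c₁)) +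
      Complex.cos (t * r) * (E0Zdot r t 0 * c₀ + E1Zdot r t 0 * c₁)) Filter.atTop (nhds H) ∧
    ‖P‖ ≤ r * ‖c₀‖ + 12 * (‖c₀‖ + ‖c₁‖) ∧ ‖H‖ ≤ 14 * (‖c₀‖ + ‖c₁‖) ∧
    ∀ t : ℝ, 0 ≤ t →
      ‖r * (E0Z r t 0 * c₀ + E1Z r t 0 * c₁) - Complex.cos (t * r) * P -
        Complex.sin (t * r) * H‖ ≤ 12 * (1 + log (1 + t)) / √(1 + t) * (‖c₀‖ + ‖c₁‖) ∧
      ‖(E0Zdot r t 0 * c₀ + E1Zdot r t 0 * c₁) + Complex.sin (t * r) * P -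
        Complex.cos (t * r) * H‖ ≤ 12 * (1 + log (1 + t)) / √(1 + t) * (‖c₀‖ + ‖c₁‖) := by
  obtain ⟨w₀, p₀, w₁, p₁, h₀, h₁, e₀, e₁, hw₀, hp₀, hw₁, hp₁⟩ := exists_isBesselPair_propagators hr
  have d₀ : ∀ t : ℝ, -1 < t → E0Zdot r t 0 = velocity w₀ p₀ t := fun t ht =>
    (h₀.hasDerivAt_of_eq e₀ ht).deriv
  have d₁ : ∀ t : ℝ, -1 < t → E1Zdot r t 0 = velocity w₁ p₁ t := fun t ht =>
    (h₁.hasDerivAt_of_eq e₁ ht).deriv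
  have h := h₀.lincomb h₁ c₀ c₁
  set w : ℝ → ℂ := fun t => c₀ * w₀ t + c₁ * w₁ t with hw
  set p : ℝ → ℂ := fun t => c₀ * p₀ t + c₁ * p₁ t with hp
  have e : ∀ t : ℝ, 0 ≤ t → E0Z r t 0 * c₀ + E1Z r t 0 * c₁ = (√(1 + t) : ℝ) * w t := by
    intro t ht
    rw [e₀ t (by linarith), e₁ t (by linarith)]
    ring
  have e' : ∀ t : ℝ, 0 ≤ t → E0Zdot r t 0 * c₀ + E1Zdot r t 0 * c₁ = velocity w p t := by
    intro t ht
    rw [d₀ t (by linarith), d₁ t (by linarith)]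
    simp only [velocity, hw, hp]
    ring
  have hw0 : ‖w 0‖ ≤ ‖c₀‖ := by
    simp only [hw, hw₁, mul_zero, add_zero, norm_mul]
    exact mul_le_of_le_one_right (norm_nonneg _) hw₀
  have hp0 : ‖p 0‖ ≤ ‖c₀‖ + ‖c₁‖ := by
    refine (norm_add_le _ _).trans (add_le_add ?_ ?_) <;> rw [norm_mul]
    · exact mul_le_of_le_one_right (norm_nonneg _) hp₀
    · exact mul_le_of_le_one_right (norm_nonneg _) hp₁
  have hc₁ := norm_nonneg c₁
  obtain ⟨P, H, hP, hH, hb⟩ := h.exists_profile (hw0.trans (by linarith)) hp0 hr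
  have hb0 := hb 0 le_rfl
  simp only [Complex.ofReal_zero, zero_mul, Complex.cos_zero, Complex.sin_zero, add_zero, one_mul,
    Real.sqrt_one, Complex.ofReal_one, log_one, mul_one, div_one, sub_zero, velocity] at hb0
  refine ⟨P, H, hP.congr' ?_, hH.congr' ?_, ?_, ?_, fun t ht => ?_⟩
  · filter_upwards [Filter.eventually_ge_atTop 0] with t ht
    rw [e t ht, e' t ht]
  · filter_upwards [Filter.eventually_ge_atTop 0] with t ht
    rw [e t ht, e' t ht]
  · have h1 := norm_le_norm_add_norm_sub (r * w 0) P
    have h2 : ‖(r : ℂ) * w 0‖ ≤ r * ‖c₀‖ := by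
      rw [norm_mul, Complex.norm_real, norm_of_nonneg hr]; gcongr
    linarith [hb0.1]
  · have h1 := norm_le_norm_add_norm_sub (w 0 / 2 + p 0) H
    have h2 : ‖w 0 / 2 + p 0‖ ≤ ‖w 0‖ / 2 + ‖p 0‖ := by
      refine (norm_add_le _ _).trans (le_of_eq ?_)
      rw [norm_div, Complex.norm_ofNat]
    linarith [hb0.2, norm_nonneg c₀]
  · rw [e t ht, e' t ht]
    exact hb t ht

lemma measurable_besselJ_zero : Measurable (besselJ 0) := by
  unfold besselJ
  refine Measurable.tsum fun k => ?_
  exact (((Complex.measurable_ofReal.div_const 2).pow_const _).const_mul _)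

lemma measurable_besselY0 : Measurable besselY0 := by
  unfold besselY0
  refine Measurable.add ?_ (Measurable.const_mul (Measurable.tsum fun k => ?_) _)
  · refine Measurable.mul ?_ measurable_besselJ_zero
    exact ((Complex.measurable_log.comp (Complex.measurable_ofReal.div_const 2)).add_const _).const_mul _
  · exact (((Complex.measurable_ofReal.div_const 2).pow_const _).const_mul _)

lemma measurable_deriv_of_differentiableAt {X : Type*} [MeasurableSpace X] {F : X → ℝ → ℂ} {t : ℝ}
    (hm : ∀ s, Measurable fun x => F x s) (hd : ∀ x, DifferentiableAt ℝ (F x) t) :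
    Measurable fun x => deriv (F x) t := by
  have hlim : Filter.Tendsto (fun n : ℕ => (1 / ((n : ℝ) + 1))) Filter.atTop
      (nhdsWithin 0 {0}ᶜ) := by
    refine tendsto_nhdsWithin_iff.2 ⟨tendsto_one_div_add_atTop_nhds_zero_nat, ?_⟩
    exact Filter.Eventually.of_forall fun n => by
      simp only [mem_compl_iff, mem_singleton_iff]; positivity
  refine measurable_of_tendsto_metrizable (f := fun (n : ℕ) x =>
    (1 / ((n : ℝ) + 1))⁻¹ • (F x (t + 1 / ((n : ℝ) + 1)) - F x t))
    (fun n => ((hm (t + 1 / ((n : ℝ) + 1))).sub (hm t)).const_smul (1 / ((n : ℝ) + 1))⁻¹) ?_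
  rw [tendsto_pi_nhds]
  exact fun x => (hasDerivAt_iff_tendsto_slope_zero.1 (hd x).hasDerivAt).comp hlim

section Measurability

variable {E : Type*} [NormedAddCommGroup E] [MeasurableSpace E] [OpensMeasurableSpace E]

lemma measurable_ePlus_s17 (t : ℝ) : Measurable fun ξ : E => ePlus 0 ‖ξ‖ t := by
  have h : Measurable fun ξ : E => (1 + t) * ‖ξ‖ := measurable_norm.const_mul _
  exact (Complex.measurable_ofReal.comp h.sqrt).mul (measurable_besselJ_zero.comp h)

lemma measurable_eMinusZ (t : ℝ) : Measurable fun ξ : E => eMinusZ ‖ξ‖ t := by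
  have h : Measurable fun ξ : E => (1 + t) * ‖ξ‖ := measurable_norm.const_mul _
  exact (Complex.measurable_ofReal.comp h.sqrt).mul (measurable_besselY0.comp h)

lemma measurable_ePlusDot_s17 : Measurable fun ξ : E => ePlusDot 0 ‖ξ‖ 0 :=
  measurable_deriv_of_differentiableAt measurable_ePlus_s17 fun ξ => by
    obtain ⟨w, p, h, he⟩ := exists_isBesselPair_ePlus (norm_nonneg ξ)
    exact (h.hasDerivAt_of_eq he (by norm_num)).differentiableAt

lemma measurable_eMinusZDot : Measurable fun ξ : E => eMinusZDot ‖ξ‖ 0 :=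
  measurable_deriv_of_differentiableAt measurable_eMinusZ fun ξ => by
    obtain ⟨w, p, h, he⟩ := exists_isBesselPair_eMinusZ (norm_nonneg ξ)
    exact (h.hasDerivAt_of_eq he (by norm_num)).differentiableAt

lemma measurable_E0Z (t : ℝ) : Measurable fun ξ : E => E0Z ‖ξ‖ t 0 :=
  (((measurable_ePlus_s17 t).mul measurable_eMinusZDot).sub
    (measurable_ePlusDot_s17.mul (measurable_eMinusZ t))).div
    (((measurable_ePlus_s17 0).mul measurable_eMinusZDot).sub
    (measurable_ePlusDot_s17.mul (measurable_eMinusZ 0)))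

lemma measurable_E1Z (t : ℝ) : Measurable fun ξ : E => E1Z ‖ξ‖ t 0 :=
  (((measurable_ePlus_s17 0).mul (measurable_eMinusZ t)).sub
    ((measurable_ePlus_s17 t).mul (measurable_eMinusZ 0))).div
    (((measurable_ePlus_s17 0).mul measurable_eMinusZDot).sub
    (measurable_ePlusDot_s17.mul (measurable_eMinusZ 0)))

lemma measurable_E0Zdot {t : ℝ} (ht : 0 ≤ t) : Measurable fun ξ : E => E0Zdot ‖ξ‖ t 0 :=
  measurable_deriv_of_differentiableAt measurable_E0Z fun ξ => by
    obtain ⟨w₀, p₀, w₁, p₁, h₀, h₁, e₀, e₁, -⟩ := exists_isBesselPair_propagators (norm_nonneg ξ)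
    exact (h₀.hasDerivAt_of_eq e₀ (by linarith)).differentiableAt

lemma measurable_E1Zdot {t : ℝ} (ht : 0 ≤ t) : Measurable fun ξ : E => E1Zdot ‖ξ‖ t 0 :=
  measurable_deriv_of_differentiableAt measurable_E1Z fun ξ => by
    obtain ⟨w₀, p₀, w₁, p₁, h₀, h₁, e₀, e₁, -⟩ := exists_isBesselPair_propagators (norm_nonneg ξ)
    exact (h₁.hasDerivAt_of_eq e₁ (by linarith)).differentiableAt

end Measurability

lemma eLpNorm_le_of_norm_le_mul_add {X : Type*} [MeasurableSpace X] {m : Measure X}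
    {f g₀ g₁ : X → ℂ} {K : ℝ} (h₀ : Measurable g₀) (h₁ : Measurable g₁)
    (hf : ∀ x, ‖f x‖ ≤ K * (‖g₀ x‖ + ‖g₁ x‖)) :
    eLpNorm f 2 m ≤ ENNReal.ofReal K * (eLpNorm g₀ 2 m + eLpNorm g₁ 2 m) := by
  have h := eLpNorm_le_mul_eLpNorm_of_ae_le_mul (μ := m) (f := f)
    (g := (fun x => ‖g₀ x‖) + fun x => ‖g₁ x‖) (c := K)
    (Filter.Eventually.of_forall fun x => by
      rw [Pi.add_apply, norm_of_nonneg (by positivity)]; exact hf x) 2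
  refine h.trans (mul_le_mul_right ?_ _)
  refine (eLpNorm_add_le h₀.norm.aestronglyMeasurable h₁.norm.aestronglyMeasurable
    (by norm_num)).trans ?_
  rw [eLpNorm_norm, eLpNorm_norm]

/-- linear scattering with asymptotic order (Fourier formulation),
`μ = 1/4` (`ν = 0`): convergence to a free wave with rate
`(1+t)^{−1/2}(1+log(1+t))`, constant independent of `t` and of the data. -/
theorem stmt17 (d : ℕ) (hd : 1 ≤ d) :
    ∃ C > (0 : ℝ), ∀ g₀ g₁ : EuclideanSpace ℝ (Fin d) → ℂ,
      Measurable g₀ → Measurable g₁ →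
      eLpNorm g₀ 2 volume < ⊤ →
      eLpNorm (fun ξ => (‖ξ‖ : ℂ) * g₀ ξ) 2 volume < ⊤ →
      eLpNorm g₁ 2 volume < ⊤ →
      ∃ gp hp : EuclideanSpace ℝ (Fin d) → ℂ, Measurable gp ∧ Measurable hp ∧
        eLpNorm (fun ξ => (‖ξ‖ : ℂ) * gp ξ) 2 volume < ⊤ ∧
        eLpNorm hp 2 volume < ⊤ ∧
        ∀ t : ℝ, 0 ≤ t →
          eLpNorm (fun ξ =>
              (‖ξ‖ : ℂ) * (E0Z ‖ξ‖ t 0 * g₀ ξ + E1Z ‖ξ‖ t 0 * g₁ ξ) -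
                (‖ξ‖ : ℂ) * Complex.cos (t * ‖ξ‖) * gp ξ -
                Complex.sin (t * ‖ξ‖) * hp ξ) 2 volume +
          eLpNorm (fun ξ =>
              (E0Zdot ‖ξ‖ t 0 * g₀ ξ + E1Zdot ‖ξ‖ t 0 * g₁ ξ) +
                (‖ξ‖ : ℂ) * Complex.sin (t * ‖ξ‖) * gp ξ -
                Complex.cos (t * ‖ξ‖) * hp ξ) 2 volume ≤
            ENNReal.ofReal (C * (1 + t) ^ (-(1 : ℝ) / 2) * (1 + Real.log (1 + t))) *
              (eLpNorm g₀ 2 volume + eLpNorm g₁ 2 volume) := by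
  refine ⟨24, by norm_num, fun g₀ g₁ hg₀ hg₁ hL₀ hL₀' hL₁ => ?_⟩
  choose P H hP hH hPb hHb hb using fun ξ : EuclideanSpace ℝ (Fin d) =>
    exists_profile_propagator (norm_nonneg ξ) (g₀ ξ) (g₁ ξ)
  have hnorm : Measurable fun ξ : EuclideanSpace ℝ (Fin d) => (‖ξ‖ : ℂ) :=
    Complex.measurable_ofReal.comp measurable_norm
  have hv : ∀ t : ℝ, Measurable fun ξ : EuclideanSpace ℝ (Fin d) =>
      (‖ξ‖ : ℂ) * (E0Z ‖ξ‖ t 0 * g₀ ξ + E1Z ‖ξ‖ t 0 * g₁ ξ) := fun t =>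
    hnorm.mul (((measurable_E0Z t).mul hg₀).add ((measurable_E1Z t).mul hg₁))
  have hv' : ∀ t : ℝ, 0 ≤ t → Measurable fun ξ : EuclideanSpace ℝ (Fin d) =>
      E0Zdot ‖ξ‖ t 0 * g₀ ξ + E1Zdot ‖ξ‖ t 0 * g₁ ξ := fun t ht =>
    ((measurable_E0Zdot ht).mul hg₀).add ((measurable_E1Zdot ht).mul hg₁)
  have hcos : ∀ t : ℝ, Measurable fun ξ : EuclideanSpace ℝ (Fin d) =>
      Complex.cos (t * ‖ξ‖) := fun t => Complex.measurable_cos.comp (hnorm.const_mul _)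
  have hsin : ∀ t : ℝ, Measurable fun ξ : EuclideanSpace ℝ (Fin d) =>
      Complex.sin (t * ‖ξ‖) := fun t => Complex.measurable_sin.comp (hnorm.const_mul _)
  have hPm : Measurable P := by
    refine measurable_of_tendsto_metrizable (fun n : ℕ => ((hcos n).mul (hv n)).sub
      ((hsin n).mul (hv' n n.cast_nonneg))) ?_
    rw [tendsto_pi_nhds]
    exact fun ξ => (hP ξ).comp tendsto_natCast_atTop_atTop
  have hHm : Measurable H := by
    refine measurable_of_tendsto_metrizable (fun n : ℕ => ((hsin n).mul (hv n)).add
      ((hcos n).mul (hv' n n.cast_nonneg))) ?_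
    rw [tendsto_pi_nhds]
    exact fun ξ => (hH ξ).comp tendsto_natCast_atTop_atTop
  have hgp : ∀ ξ, (‖ξ‖ : ℂ) * (P ξ / ‖ξ‖) = P ξ := by
    intro ξ
    by_cases hξ : (‖ξ‖ : ℂ) = 0
    · have h := hP ξ
      simp only [hξ, mul_zero, zero_mul, Complex.sin_zero, sub_zero] at h
      rw [hξ, zero_mul, tendsto_nhds_unique h tendsto_const_nhds]
    · rw [mul_div_cancel₀ _ hξ]
  have hfin : eLpNorm g₀ 2 volume + eLpNorm g₁ 2 volume < ⊤ := ENNReal.add_lt_top.2 ⟨hL₀, hL₁⟩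
  refine ⟨fun ξ => P ξ / ‖ξ‖, H, hPm.div hnorm, hHm, ?_, ?_, fun t ht => ?_⟩
  · simp only [hgp]
    have hg : eLpNorm (fun ξ => 12 * (‖g₀ ξ‖ + ‖g₁ ξ‖)) 2 volume < ⊤ := by
      have h₁ : MemLp g₁ 2 volume := ⟨hg₁.aestronglyMeasurable, hL₁⟩
      have h₀ : MemLp g₀ 2 volume := ⟨hg₀.aestronglyMeasurable, hL₀⟩
      exact ((h₀.norm.add h₁.norm).const_mul 12).2
    have h₂ : MemLp (fun ξ => (‖ξ‖ : ℂ) * g₀ ξ) 2 volume :=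
      ⟨(hnorm.mul hg₀).aestronglyMeasurable, hL₀'⟩
    have hsum := h₂.norm.add (g := fun ξ => 12 * (‖g₀ ξ‖ + ‖g₁ ξ‖))
      ⟨((hg₀.norm.add hg₁.norm).const_mul 12).aestronglyMeasurable, hg⟩
    refine (eLpNorm_mono_real fun ξ => ?_).trans_lt hsum.2
    refine (hPb ξ).trans (le_of_eq ?_)
    simp
  · exact (eLpNorm_le_of_norm_le_mul_add hg₀ hg₁ hHb).trans_lt
      (ENNReal.mul_lt_top ENNReal.ofReal_lt_top hfin)
  · have hK : 0 ≤ 12 * (1 + log (1 + t)) / √(1 + t) := by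
      have : 0 ≤ log (1 + t) := Real.log_nonneg (by linarith)
      positivity
    have hC : ENNReal.ofReal (24 * (1 + t) ^ (-(1 : ℝ) / 2) * (1 + Real.log (1 + t))) =
        ENNReal.ofReal (12 * (1 + log (1 + t)) / √(1 + t)) +
        ENNReal.ofReal (12 * (1 + log (1 + t)) / √(1 + t)) := by
      rw [← ENNReal.ofReal_add hK hK, neg_div, Real.rpow_neg (by linarith), ← Real.sqrt_eq_rpow]
      congr 1
      ring
    rw [hC, add_mul]
    refine add_le_add (eLpNorm_le_of_norm_le_mul_add hg₀ hg₁ fun ξ => ?_)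
      (eLpNorm_le_of_norm_le_mul_add hg₀ hg₁ fun ξ => ?_)
    · refine le_trans (le_of_eq ?_) (hb ξ t ht).1
      congr 1
      linear_combination (-Complex.cos (t * ‖ξ‖)) * hgp ξ
    · refine le_trans (le_of_eq ?_) (hb ξ t ht).2
      congr 1
      linear_combination Complex.sin (t * ‖ξ‖) * hgp ξ

end
end
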